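/- arXiv:2103.05474 — 2 statements merged into one kernel-verified Lean document; each statement's English description precedes it below -/
import Mathlib

section
/- Let Z be a PMM satisfying assumptions A1 and A2, and suppose Z is positive Harris. Then there exists α ∈ (0,1) such that for every s ≥ 1 there exists a σ(X_{s:∞})-measurable random variable C_s < ∞ such that for all t ≥ s ≥ l ≥ 1, almost surely ‖P(Y_{t:∞} ∈ · | X_{l:∞}) − P(Y_{t:∞} ∈ · | X_{s:∞})‖_TV ≤ C_s α^{t−s}, where the conditional distributions are regular versions on the cylindrical σ-algebra of Y^∞ given the full observation σ-fields σ(X_{l:∞}) and σ(X_{s:∞}). -/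
open MeasureTheory ProbabilityTheory ENNReal

namespace PMMPaper

/-! ### General Markov chain notions (general state space) -/

section Kernels

variable {S : Type*} [MeasurableSpace S]

open Classical in
/-- `kpow κ k` is the `k`-step transition kernel of a Markov chain with one-step kernel `κ`. -/
noncomputable def kpow (κ : Kernel S S) : ℕ → Kernel S S
  | 0 => Kernel.id
  | n + 1 => kpow κ n ∘ₖ κ

/-- `φ` is an irreducibility measure for the chain with kernel `κ`:
`φ(A) > 0` implies that from every point `z` some `k`-step transition reaches `A`
with positive probability. -/
def IsIrreducibilityMeasure (κ : Kernel S S) (φ : Measure S) : Prop :=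
  ∀ A : Set S, MeasurableSet A → 0 < φ A → ∀ z : S, ∃ k : ℕ, 1 ≤ k ∧ 0 < kpow κ k z A

/-- `ψ` is a maximal irreducibility measure: a σ-finite irreducibility measure dominating
every other σ-finite irreducibility measure. -/
def IsMaxIrreducibilityMeasure (κ : Kernel S S) (ψ : Measure S) : Prop :=
  SigmaFinite ψ ∧ IsIrreducibilityMeasure κ ψ ∧
    ∀ φ : Measure S, SigmaFinite φ → IsIrreducibilityMeasure κ φ → φ ≪ ψ

/-- `Pz` is the family of laws (on the path space `ℕ → S`) of the Markov chain with
transition kernel `κ` started at the point `z`:  `Pz z` is a probability measure under which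
the coordinate process starts at `z` and is Markov with kernel `κ`. -/
def IsMarkovFamily (κ : Kernel S S) (Pz : S → Measure (ℕ → S)) : Prop :=
  (∀ z : S, IsProbabilityMeasure (Pz z)) ∧
  (∀ z : S, Pz z {ω | ω 0 = z} = 1) ∧
  ∀ (z : S) (n : ℕ) (g : S → ℝ≥0∞), Measurable g → ∀ C : Set (ℕ → S),
    MeasurableSet[⨆ i ∈ Set.Iic n, MeasurableSpace.comap (fun ω : ℕ → S => ω i) inferInstance] C →
    ∫⁻ ω in C, g (ω (n + 1)) ∂(Pz z) = ∫⁻ ω in C, ∫⁻ z', g z' ∂(κ (ω n)) ∂(Pz z)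

/-- Harris recurrence property (relative to the measure `ψ`): every set charged by `ψ` is
visited infinitely often, almost surely, from every starting point. -/
def HarrisProp (κ : Kernel S S) (Pz : S → Measure (ℕ → S)) (ψ : Measure S) : Prop :=
  ∀ A : Set S, MeasurableSet A → 0 < ψ A → ∀ z : S,
    Pz z {ω | ∀ N : ℕ, ∃ k : ℕ, N ≤ k ∧ ω k ∈ A} = 1

/-- `π` is an invariant measure for the kernel `κ`. -/
def IsInvariantMeasure (κ : Kernel S S) (π : Measure S) : Prop :=
  π.bind (fun z => κ z) = π

/-- The chain is positive: its transition kernel admits an invariant probability measure. -/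
def IsPositive (κ : Kernel S S) : Prop :=
  ∃ π : Measure S, IsProbabilityMeasure π ∧ IsInvariantMeasure κ π

/-- The process `Z` on `(Ω, P)` is a homogeneous Markov chain with transition kernel `κ`. -/
def IsMarkovChain {Ω : Type*} [MeasurableSpace Ω] (P : Measure Ω) (Z : ℕ → Ω → S)
    (κ : Kernel S S) : Prop :=
  (∀ k : ℕ, Measurable (Z k)) ∧
  ∀ (n : ℕ) (g : S → ℝ≥0∞), Measurable g → ∀ C : Set Ω,
    MeasurableSet[⨆ i ∈ Set.Iic n, MeasurableSpace.comap (Z i) inferInstance] C →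
    ∫⁻ ω in C, g (Z (n + 1) ω) ∂P = ∫⁻ ω in C, ∫⁻ z', g z' ∂(κ (Z n ω)) ∂P

/-- The process `Z : ℤ → Ω → S` on `(Ω, P)` is a (two-sided) homogeneous Markov chain
with transition kernel `κ`. -/
def IsMarkovChainZ {Ω : Type*} [MeasurableSpace Ω] (P : Measure Ω) (Z : ℤ → Ω → S)
    (κ : Kernel S S) : Prop :=
  (∀ k : ℤ, Measurable (Z k)) ∧
  ∀ (n : ℤ) (g : S → ℝ≥0∞), Measurable g → ∀ C : Set Ω,
    MeasurableSet[⨆ i ∈ Set.Iic n, MeasurableSpace.comap (Z i) inferInstance] C →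
    ∫⁻ ω in C, g (Z (n + 1) ω) ∂P = ∫⁻ ω in C, ∫⁻ z', g z' ∂(κ (Z n ω)) ∂P

/-- The reversed-time process of the two-sided chain `Z` is a Markov chain with kernel `κ'`. -/
def IsRevMarkovChainZ {Ω : Type*} [MeasurableSpace Ω] (P : Measure Ω) (Z : ℤ → Ω → S)
    (κ' : Kernel S S) : Prop :=
  ∀ (n : ℤ) (g : S → ℝ≥0∞), Measurable g → ∀ C : Set Ω,
    MeasurableSet[⨆ i ∈ Set.Ici n, MeasurableSpace.comap (Z i) inferInstance] C →
    ∫⁻ ω in C, g (Z (n - 1) ω) ∂P = ∫⁻ ω in C, ∫⁻ z', g z' ∂(κ' (Z n ω)) ∂P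

/-- The two-sided process `Z` is stationary: all finite-dimensional distributions are
invariant under time shifts. -/
def IsStationaryZ {Ω : Type*} [MeasurableSpace Ω] (P : Measure Ω) (Z : ℤ → Ω → S) : Prop :=
  ∀ (k : ℤ) (n : ℕ),
    P.map (fun ω => fun i : Fin n => Z (k + (i : ℕ)) ω) =
      P.map (fun ω => fun i : Fin n => Z ((i : ℕ) : ℤ) ω)

/-- First-coordinate projection `A_(1)` of a set of finite strings. -/
def proj1 {α : Type*} {R : ℕ} (A : Set (Fin (R + 1) → α)) : Set α :=
  (fun x => x 0) '' A

/-- The section `A(a) = {x_{2:r} : (a, x_{2:r}) ∈ A}`. -/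
def secSet {α : Type*} {R : ℕ} (A : Set (Fin (R + 1) → α)) (a : α) : Set (Fin R → α) :=
  {xr | Fin.cons a xr ∈ A}

end Kernels

/-! ### Pairwise Markov models -/

variable {𝓧 : Type*} [MeasurableSpace 𝓧] {𝓨 : Type*} [Fintype 𝓨] [DecidableEq 𝓨]
  [MeasurableSpace 𝓨] [MeasurableSingletonClass 𝓨] [Nonempty 𝓨]
  {Ω : Type*} [MeasurableSpace Ω]

/-- `Z` is a pairwise Markov model on `(Ω, P)`: a homogeneous Markov chain on `𝓧 × 𝓨`
whose transition kernel `κ` has density `q(z'|z)` with respect to `μ × count`, and whose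
initial distribution has density `p0` with respect to `μ × count`. -/
def IsPMM (P : Measure Ω) (Z : ℕ → Ω → 𝓧 × 𝓨) (κ : Kernel (𝓧 × 𝓨) (𝓧 × 𝓨))
    (μ : Measure 𝓧) (q : 𝓧 × 𝓨 → 𝓧 × 𝓨 → ℝ≥0∞) (p0 : 𝓧 × 𝓨 → ℝ≥0∞) : Prop :=
  IsProbabilityMeasure P ∧ IsMarkovChain P Z κ ∧ SigmaFinite μ ∧
  Measurable (Function.uncurry q) ∧ Measurable p0 ∧
  (∀ z : 𝓧 × 𝓨, (κ z : Measure (𝓧 × 𝓨)) =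
      (μ.prod Measure.count).withDensity (fun z' => q z' z)) ∧
  P.map (Z 0) = (μ.prod Measure.count).withDensity p0

/-- Two-sided version of `IsPMM`. -/
def IsPMMZ (P : Measure Ω) (Z : ℤ → Ω → 𝓧 × 𝓨) (κ : Kernel (𝓧 × 𝓨) (𝓧 × 𝓨))
    (μ : Measure 𝓧) (q : 𝓧 × 𝓨 → 𝓧 × 𝓨 → ℝ≥0∞) (p0 : 𝓧 × 𝓨 → ℝ≥0∞) : Prop :=
  IsProbabilityMeasure P ∧ IsMarkovChainZ P Z κ ∧ SigmaFinite μ ∧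
  Measurable (Function.uncurry q) ∧ Measurable p0 ∧
  (∀ z : 𝓧 × 𝓨, (κ z : Measure (𝓧 × 𝓨)) =
      (μ.prod Measure.count).withDensity (fun z' => q z' z)) ∧
  P.map (Z 0) = (μ.prod Measure.count).withDensity p0

/-- `pijD q x i j` is the conditional density
`p_{ij}(x_{1:r}) = p(x_{2:r}, y_r = j | x_1, y_1 = i)` (a string `x` of length `R+1`). -/
noncomputable def pijD (q : 𝓧 × 𝓨 → 𝓧 × 𝓨 → ℝ≥0∞) {R : ℕ} (x : Fin (R + 1) → 𝓧)
    (i j : 𝓨) : ℝ≥0∞ :=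
  ∑ y : Fin (R + 1) → 𝓨,
    (if y 0 = i ∧ y (Fin.last R) = j then
      ∏ k : Fin R, q (x k.succ, y k.succ) (x k.castSucc, y k.castSucc) else 0)

/-- `pmidD q x i t j` is the density `p(y_{t+1} = j, x_{2:r} | x_1, y_1 = i)`. -/
noncomputable def pmidD (q : 𝓧 × 𝓨 → 𝓧 × 𝓨 → ℝ≥0∞) {R : ℕ} (x : Fin (R + 1) → 𝓧)
    (i : 𝓨) (t : Fin (R + 1)) (j : 𝓨) : ℝ≥0∞ :=
  ∑ y : Fin (R + 1) → 𝓨,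
    (if y 0 = i ∧ y t = j then
      ∏ k : Fin R, q (x k.succ, y k.succ) (x k.castSucc, y k.castSucc) else 0)

/-- `pxD q x i = p(x_{2:r} | x_1, y_1 = i)`. -/
noncomputable def pxD (q : 𝓧 × 𝓨 → 𝓧 × 𝓨 → ℝ≥0∞) {R : ℕ} (x : Fin (R + 1) → 𝓧)
    (i : 𝓨) : ℝ≥0∞ :=
  ∑ j : 𝓨, pijD q x i j

/-- The set `Y⁺(x_{1:r}) = {(i,j) : p_{ij}(x_{1:r}) > 0}`. -/
def Yplus (q : 𝓧 × 𝓨 → 𝓧 × 𝓨 → ℝ≥0∞) {R : ℕ} (x : Fin (R + 1) → 𝓧) : Set (𝓨 × 𝓨) :=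
  {p : 𝓨 × 𝓨 | 0 < pijD q x p.1 p.2}

/-- Joint density `p(x_{1:r}, y_{1:r})` of `Z_{1:r}`, built from the initial density `p0`
and the transition density `q`. -/
noncomputable def jointD (p0 : 𝓧 × 𝓨 → ℝ≥0∞) (q : 𝓧 × 𝓨 → 𝓧 × 𝓨 → ℝ≥0∞) {R : ℕ}
    (x : Fin (R + 1) → 𝓧) (y : Fin (R + 1) → 𝓨) : ℝ≥0∞ :=
  p0 (x 0, y 0) * ∏ k : Fin R, q (x k.succ, y k.succ) (x k.castSucc, y k.castSucc)

/-- Density `p(x_{1:r})` of the observations `X_{1:r}`. -/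
noncomputable def pXD (p0 : 𝓧 × 𝓨 → ℝ≥0∞) (q : 𝓧 × 𝓨 → 𝓧 × 𝓨 → ℝ≥0∞) {R : ℕ}
    (x : Fin (R + 1) → 𝓧) : ℝ≥0∞ :=
  ∑ y : Fin (R + 1) → 𝓨, jointD p0 q x y

/-- The set `Y*(x_{1:r}) = {(y_1, y_r) : ∃ y_{2:r-1}, p(x_{1:r}, y_{1:r}) > 0}`. -/
def Ystar (p0 : 𝓧 × 𝓨 → ℝ≥0∞) (q : 𝓧 × 𝓨 → 𝓧 × 𝓨 → ℝ≥0∞) {R : ℕ}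
    (x : Fin (R + 1) → 𝓧) : Set (𝓨 × 𝓨) :=
  {p : 𝓨 × 𝓨 | ∃ y : Fin (R + 1) → 𝓨,
    y 0 = p.1 ∧ y (Fin.last R) = p.2 ∧ 0 < jointD p0 q x y}

/-- Assumption **A1**: there is `r = R + 1 > 1` and a set `E ⊆ 𝓧^r` on which
`Y⁺(x_{1:r}) = Y⁺` is constant, nonempty, and a product set. -/
def Assumption1 (q : 𝓧 × 𝓨 → 𝓧 × 𝓨 → ℝ≥0∞) {R : ℕ} (E : Set (Fin (R + 1) → 𝓧))
    (Yp : Set (𝓨 × 𝓨)) : Prop :=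
  1 ≤ R ∧ Yp.Nonempty ∧ (∀ x ∈ E, Yplus q x = Yp) ∧
    Yp = (Prod.fst '' Yp) ×ˢ (Prod.snd '' Yp)

/-- Assumption **A2**: `ψ` is a maximal irreducibility measure for the chain,
`ψ(E_(1) × Y⁺_(1)) > 0` and `μ^{r-1}(E(x₁)) > 0` for all `x₁ ∈ E_(1)`. -/
def Assumption2 (κ : Kernel (𝓧 × 𝓨) (𝓧 × 𝓨)) (ψ : Measure (𝓧 × 𝓨)) (μ : Measure 𝓧)
    {R : ℕ} (E : Set (Fin (R + 1) → 𝓧)) (Yp : Set (𝓨 × 𝓨)) : Prop :=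
  IsMaxIrreducibilityMeasure κ ψ ∧
  0 < ψ (proj1 E ×ˢ (Prod.fst '' Yp)) ∧
  ∀ x₁ ∈ proj1 E, 0 < (Measure.pi fun _ : Fin R => μ) (secSet E x₁)

/-- Assumption **A1'** (stationary case): `Y*(x_{1:r}) = Y*` is constant on `E`,
nonempty and a product set. -/
def Assumption1' (p0 : 𝓧 × 𝓨 → ℝ≥0∞) (q : 𝓧 × 𝓨 → 𝓧 × 𝓨 → ℝ≥0∞) {R : ℕ}
    (E : Set (Fin (R + 1) → 𝓧)) (Ys : Set (𝓨 × 𝓨)) : Prop :=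
  1 ≤ R ∧ Ys.Nonempty ∧ (∀ x ∈ E, Ystar p0 q x = Ys) ∧
    Ys = (Prod.fst '' Ys) ×ˢ (Prod.snd '' Ys)

/-- Assumption **A2'**: `μ^r(E) > 0`. -/
def Assumption2' (μ : Measure 𝓧) {R : ℕ} (E : Set (Fin (R + 1) → 𝓧)) : Prop :=
  0 < (Measure.pi fun _ : Fin (R + 1) => μ) E

/-! ### Smoothing distributions -/

/-- The σ-algebra `σ(X_{l:n})` generated by the observations with indices in `[l, n]`. -/
noncomputable def obsSigma (Z : ℕ → Ω → 𝓧 × 𝓨) (l n : ℕ) : MeasurableSpace Ω :=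
  ⨆ i ∈ Set.Icc l n, MeasurableSpace.comap (fun ω => (Z i ω).1) inferInstance

/-- The σ-algebra `σ(X_{s:∞})` generated by the observations with indices `≥ s`. -/
noncomputable def obsSigmaFrom (Z : ℕ → Ω → 𝓧 × 𝓨) (s : ℕ) : MeasurableSpace Ω :=
  ⨆ i ∈ Set.Ici s, MeasurableSpace.comap (fun ω => (Z i ω).1) inferInstance

/-- The smoothing probability `ν^t_{l:n;m}(v) = P(Y_{t:t+m-1} = v | X_{l:n})`,
realized as a conditional expectation of an indicator. -/
noncomputable def smooth (P : Measure Ω) (Z : ℕ → Ω → 𝓧 × 𝓨) (t l n : ℕ) {m : ℕ}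
    (v : Fin m → 𝓨) : Ω → ℝ :=
  P[Set.indicator {ω | ∀ i : Fin m, (Z (t + (i : ℕ)) ω).2 = v i} (fun _ => (1 : ℝ)) |
    obsSigma Z l n]

/-- Total variation distance `‖ν^t_{l:n;m} − ν^t_{s:n;m}‖_TV`. -/
noncomputable def tvBlock (P : Measure Ω) (Z : ℕ → Ω → 𝓧 × 𝓨) (t l s n m : ℕ) (ω : Ω) : ℝ :=
  ∑ v : Fin m → 𝓨, |smooth P Z t l n v ω - smooth P Z t s n v ω|

/-- Two-sided version: the σ-algebra `σ(X_i ; i ∈ I)` for `I ⊆ ℤ`. -/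
noncomputable def obsSigmaZ (Z : ℤ → Ω → 𝓧 × 𝓨) (I : Set ℤ) : MeasurableSpace Ω :=
  ⨆ i ∈ I, MeasurableSpace.comap (fun ω => (Z i ω).1) inferInstance

/-- Two-sided smoothing probability `P(Y_{t:t+m-1} = v | X_i ; i ∈ I)`. -/
noncomputable def smoothZ (P : Measure Ω) (Z : ℤ → Ω → 𝓧 × 𝓨) (t : ℤ) (I : Set ℤ) {m : ℕ}
    (v : Fin m → 𝓨) : Ω → ℝ :=
  P[Set.indicator {ω | ∀ i : Fin m, (Z (t + (i : ℕ)) ω).2 = v i} (fun _ => (1 : ℝ)) |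
    obsSigmaZ Z I]

/-- Two-sided total variation distance between smoothing distributions with observation
index sets `I` and `J`. -/
noncomputable def tvBlockZ (P : Measure Ω) (Z : ℤ → Ω → 𝓧 × 𝓨) (t : ℤ) (I J : Set ℤ)
    (m : ℕ) (ω : Ω) : ℝ :=
  ∑ v : Fin m → 𝓨, |smoothZ P Z t I v ω - smoothZ P Z t J v ω|

/-! ### Counters, Doeblin matrices -/

/-- `κ_k(X_{s:t})`: the number of (almost non-overlapping) `E`-blocks of length `R+1`
in the observed string, counting from position `s + k` (paper's `κ_k`, `r' = R`). -/
noncomputable def kapCount (Z : ℕ → Ω → 𝓧 × 𝓨) {R : ℕ} (E : Set (Fin (R + 1) → 𝓧))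
    (s t kk : ℕ) (ω : Ω) : ℕ :=
  ∑ u ∈ Finset.range ((t - kk - s) / R),
    Set.indicator E (fun _ => 1) (fun i : Fin (R + 1) => (Z (u * R + s + kk + (i : ℕ)) ω).1)

/-- `κ̄(X_{s:t})`: the backward counter, counting `E`-blocks from position `t` backwards. -/
noncomputable def kapBar (Z : ℕ → Ω → 𝓧 × 𝓨) {R : ℕ} (E : Set (Fin (R + 1) → 𝓧))
    (s t : ℕ) (ω : Ω) : ℕ :=
  ∑ u ∈ Finset.range ((t - s) / R),
    Set.indicator E (fun _ => 1) (fun i : Fin (R + 1) => (Z (t - (u + 1) * R + (i : ℕ)) ω).1)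

open Classical in
/-- The segment `x_{a+1:b+1}` (0-based indices `a..b`) of a string of length `L+1`. -/
def segv {L : ℕ} (x : Fin (L + 1) → 𝓧) (a b : ℕ) (hab : a ≤ b) (hb : b ≤ L) :
    Fin (b - a + 1) → 𝓧 :=
  fun i => x ⟨a + (i : ℕ), by omega⟩

/-- Normalizing constant `c(x_{r:n}) = ∑_{j ∈ Y₂} p(x_{r+1:n} | x_r, y_r = j)`. -/
noncomputable def normC (q : 𝓧 × 𝓨 → 𝓧 × 𝓨 → ℝ≥0∞) (Y2 : Set 𝓨) {M : ℕ}
    (w : Fin (M + 1) → 𝓧) : ℝ≥0∞ :=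
  ∑ j : 𝓨, Set.indicator Y2 (fun j' => pxD q w j') j

/-- The probability vector `λ[x_{r:n}](j)`. -/
noncomputable def lamD (q : 𝓧 × 𝓨 → 𝓧 × 𝓨 → ℝ≥0∞) (Y2 : Set 𝓨) {M : ℕ}
    (w : Fin (M + 1) → 𝓧) (j : 𝓨) : ℝ≥0∞ :=
  Set.indicator Y2 (fun j' => pxD q w j') j / normC q Y2 w

/-- The matrix `U[x_{1:n}](i,j)`; a version of `P(Y_r = j | X_{1:n} = x_{1:n}, Y_1 = i)`. -/
noncomputable def UMat (q : 𝓧 × 𝓨 → 𝓧 × 𝓨 → ℝ≥0∞) (Y2 : Set 𝓨) {L R : ℕ} (hR : R ≤ L)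
    (x : Fin (L + 1) → 𝓧) (i j : 𝓨) : ℝ≥0∞ :=
  if 0 < pxD q x i then pmidD q x i ⟨R, by omega⟩ j / pxD q x i
  else lamD q Y2 (segv x R L hR (le_refl L)) j

/-! ### Total variation of measures, conditional laws of `Y_{t:∞}` -/

open Classical in
/-- Total variation distance between two measures (normalized as in the paper:
`‖P − Q‖_TV = 2 sup_A |P(A) − Q(A)|`). -/
noncomputable def tvDistM {W : Type*} [MeasurableSpace W] (ρ₁ ρ₂ : Measure W) : ℝ≥0∞ :=
  2 * ⨆ (A : Set W) (_ : MeasurableSet A), ((ρ₁ A - ρ₂ A) ⊔ (ρ₂ A - ρ₁ A))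

/-- The observation vector `X_{l:n}`. -/
def obsVec (Z : ℕ → Ω → 𝓧 × 𝓨) (l n : ℕ) (ω : Ω) : Fin (n + 1 - l) → 𝓧 :=
  fun i => (Z (l + (i : ℕ)) ω).1

/-- The tail signal process `Y_{t:∞}`. -/
def tailY (Z : ℕ → Ω → 𝓧 × 𝓨) (t : ℕ) (ω : Ω) : ℕ → 𝓨 :=
  fun k => (Z (t + k) ω).2

/-- The observation tail `X_{l:∞}`. -/
def obsTail (Z : ℕ → Ω → 𝓧 × 𝓨) (l : ℕ) (ω : Ω) : ℕ → 𝓧 :=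
  fun k => (Z (l + k) ω).1

/-- A regular version of the conditional distribution `P(Y_{t:∞} ∈ · | X_{l:n})`,
evaluated at `ω`. -/
noncomputable def condLawTail (P : Measure Ω) [IsFiniteMeasure P] (Z : ℕ → Ω → 𝓧 × 𝓨)
    (t l n : ℕ) (ω : Ω) : Measure (ℕ → 𝓨) :=
  condDistrib (tailY Z t) (obsVec Z l n) P (obsVec Z l n ω)

/-- A regular version of the conditional distribution `P(Y_{t:∞} ∈ · | X_{l:∞})`,
evaluated at `ω`. -/
noncomputable def condLawTailInf (P : Measure Ω) [IsFiniteMeasure P] (Z : ℕ → Ω → 𝓧 × 𝓨)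
    (t l : ℕ) (ω : Ω) : Measure (ℕ → 𝓨) :=
  condDistrib (tailY Z t) (obsTail Z l) P (obsTail Z l ω)

/-! ### Hidden Markov models and matrices -/

/-- Powers of a nonnegative matrix on `𝓨`. -/
noncomputable def matpow (p : 𝓨 → 𝓨 → ℝ≥0∞) : ℕ → 𝓨 → 𝓨 → ℝ≥0∞
  | 0 => fun i j => if i = j then 1 else 0
  | n + 1 => fun i j => ∑ k : 𝓨, matpow p n i k * p k j

/-- The sub-matrix `ℙ_C` of `p` with rows and columns restricted to `C` (and `0` outside). -/
noncomputable def subMat (p : 𝓨 → 𝓨 → ℝ≥0∞) (C : Set 𝓨) : 𝓨 → 𝓨 → ℝ≥0∞ :=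
  fun i j => Set.indicator (C ×ˢ C) (fun ij : 𝓨 × 𝓨 => p ij.1 ij.2) (i, j)

/-- Support `G_i = {x : f_i(x) > 0}` of the emission density `f_i`. -/
def emisSupp (f : 𝓨 → 𝓧 → ℝ≥0∞) (i : 𝓨) : Set 𝓧 :=
  {x | 0 < f i x}

/-- `C` is a cluster: `μ[(∩_{i∈C} G_i) \ (∪_{i∉C} G_i)] > 0`. -/
def IsCluster (μ : Measure 𝓧) (f : 𝓨 → 𝓧 → ℝ≥0∞) (C : Set 𝓨) : Prop :=
  0 < μ ((⋂ i ∈ C, emisSupp f i) \ (⋃ i ∈ Cᶜ, emisSupp f i))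

set_option linter.unusedSectionVars false

section GeneralMarkov

variable {S : Type*} [MeasurableSpace S]

/-- Past sigma-algebra. -/
abbrev pastSig {Ω' : Type*} (Z : ℕ → Ω' → S) (n : ℕ) : MeasurableSpace Ω' :=
  ⨆ i ∈ Set.Iic n, MeasurableSpace.comap (Z i) inferInstance

lemma pastSig_le {Ω' : Type*} [MeasurableSpace Ω'] {Z : ℕ → Ω' → S}
    (hZ : ∀ k, Measurable (Z k)) (n : ℕ) :
    pastSig Z n ≤ (inferInstance : MeasurableSpace Ω') :=
  iSup₂_le fun i _ => (hZ i).comap_le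

lemma measurable_pastSig {Ω' : Type*} {Z : ℕ → Ω' → S} {i n : ℕ} (h : i ≤ n) :
    Measurable[pastSig Z n] (Z i) := by
  intro s hs
  have : MeasurableSpace.comap (Z i) inferInstance ≤ pastSig Z n :=
    le_iSup₂_of_le i (Set.mem_Iic.2 h) le_rfl
  exact this _ ⟨s, hs, rfl⟩

lemma pastSig_mono {Ω' : Type*} {Z : ℕ → Ω' → S} {m n : ℕ} (h : m ≤ n) :
    pastSig Z m ≤ pastSig Z n := by
  refine iSup₂_le fun i hi => ?_
  exact le_iSup₂_of_le i (Set.mem_Iic.2 ((Set.mem_Iic.1 hi).trans h)) le_rfl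

variable {Ω' : Type*} [MeasurableSpace Ω'] {κ : Kernel S S}

lemma markov_fun {m : Measure Ω'} {Z : ℕ → Ω' → S} (h : IsMarkovChain m Z κ) (n : ℕ)
    {g : S → ℝ≥0∞} (hg : Measurable g) {ξ : Ω' → ℝ≥0∞} (hξ : Measurable[pastSig Z n] ξ) :
    ∫⁻ ω, ξ ω * g (Z (n + 1) ω) ∂m = ∫⁻ ω, ξ ω * ∫⁻ z', g z' ∂(κ (Z n ω)) ∂m := by
  have hm := pastSig_le h.1 n
  have hξ' : Measurable ξ := hξ.mono hm le_rfl
  have h1 : Measurable fun ω => g (Z (n + 1) ω) := hg.comp (h.1 _)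
  have h2 : Measurable fun ω => ∫⁻ z', g z' ∂(κ (Z n ω)) :=
    (Measurable.lintegral_kernel hg).comp (h.1 n)
  have key : (m.withDensity fun ω => g (Z (n + 1) ω)).trim hm
      = (m.withDensity fun ω => ∫⁻ z', g z' ∂(κ (Z n ω))).trim hm := by
    refine @Measure.ext _ (pastSig Z n) _ _ fun C hC => ?_
    rw [trim_measurableSet_eq hm hC, trim_measurableSet_eq hm hC,
      withDensity_apply _ (hm _ hC), withDensity_apply _ (hm _ hC)]
    exact h.2 n g hg C hC
  have e1 := lintegral_trim (μ := m.withDensity fun ω => g (Z (n + 1) ω)) hm hξ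
  have e2 := lintegral_trim (μ := m.withDensity fun ω => ∫⁻ z', g z' ∂(κ (Z n ω))) hm hξ
  rw [key, e2, lintegral_withDensity_eq_lintegral_mul _ h2 hξ',
    lintegral_withDensity_eq_lintegral_mul _ h1 hξ'] at e1
  simp only [Pi.mul_apply] at e1
  simp only [mul_comm (ξ _)]
  exact e1.symm

lemma famChain {Pz : S → Measure (ℕ → S)} (hF : IsMarkovFamily κ Pz) (z : S) :
    IsMarkovChain (Pz z) (fun k (ω : ℕ → S) => ω k) κ :=
  ⟨fun k => measurable_pi_apply k, fun n g hg C hC => hF.2.2 z n g hg C hC⟩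

lemma fam_zero [MeasurableSingletonClass S] {Pz : S → Measure (ℕ → S)}
    (hF : IsMarkovFamily κ Pz) (z : S) :
    ∀ᵐ ω ∂(Pz z), ω 0 = z := by
  have := hF.1 z
  have hm : MeasurableSet {ω : ℕ → S | ω 0 = z} :=
    (measurable_pi_apply (X := fun _ : ℕ => S) 0) (measurableSet_singleton z)
  exact (mem_ae_iff_prob_eq_one hm).2 (hF.2.1 z)

lemma chain_fold {m : Measure Ω'} {Z : ℕ → Ω' → S} (h : IsMarkovChain m Z κ) (n : ℕ)
    {g : ℕ → S → ℝ≥0∞} (hg : ∀ i, Measurable (g i)) :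
    ∫⁻ ω, ∏ i ∈ Finset.range (n + 1 + 1), g i (Z i ω) ∂m
      = ∫⁻ ω, ∏ i ∈ Finset.range (n + 1),
          (Function.update g n (fun z => g n z * ∫⁻ z', g (n + 1) z' ∂(κ z))) i (Z i ω) ∂m := by
  have h1 : Measurable[pastSig Z n] fun ω => ∏ i ∈ Finset.range (n + 1), g i (Z i ω) := by
    refine Finset.measurable_fun_prod _ fun i hi => ?_
    exact (hg i).comp (measurable_pastSig (by simp at hi; omega))
  have := markov_fun h n (hg (n + 1)) h1
  simp only [Finset.prod_range_succ _ (n + 1)]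
  rw [this]
  refine lintegral_congr fun ω => ?_
  simp only [Finset.prod_range_succ, Function.update_self]
  rw [mul_assoc]
  congr 1
  refine Finset.prod_congr rfl fun i hi => ?_
  rw [Function.update_of_ne]
  simp at hi; omega

lemma prod_eq [MeasurableSingletonClass S] {Pz : S → Measure (ℕ → S)}
    (hF : IsMarkovFamily κ Pz) (n : ℕ) :
    ∀ g : ℕ → S → ℝ≥0∞, (∀ i, Measurable (g i)) →
    Measurable (fun z => ∫⁻ ω, ∏ i ∈ Finset.range (n + 1), g i (ω i) ∂(Pz z)) ∧
    ∀ (m : Measure Ω') (Z : ℕ → Ω' → S), IsMarkovChain m Z κ →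
    ∫⁻ ω, ∏ i ∈ Finset.range (n + 1), g i (Z i ω) ∂m =
      ∫⁻ ω, (∫⁻ ω', ∏ i ∈ Finset.range (n + 1), g i (ω' i) ∂(Pz (Z 0 ω))) ∂m := by
  induction n with
  | zero =>
    intro g hg
    have e : ∀ z, ∫⁻ ω, ∏ i ∈ Finset.range (0 + 1), g i (ω i) ∂(Pz z) = g 0 z := by
      intro z
      have := hF.1 z
      rw [lintegral_congr_ae (g := fun _ => g 0 z)]
      · simp
      · filter_upwards [fam_zero hF z] with ω hω
        simp [hω]
    simp only [e]
    exact ⟨hg 0, fun m Z h => by simp⟩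
  | succ n ih =>
    intro g hg
    have hg' : ∀ i, Measurable
        ((Function.update g n (fun z => g n z * ∫⁻ z', g (n + 1) z' ∂(κ z))) i) := by
      intro i
      rcases eq_or_ne i n with rfl | hi
      · rw [Function.update_self]
        exact (hg i).mul (Measurable.lintegral_kernel (hg (i + 1)))
      · rw [Function.update_of_ne hi]; exact hg i
    obtain ⟨i1, i2⟩ := ih _ hg'
    have e : ∀ z, ∫⁻ ω, ∏ i ∈ Finset.range (n + 1 + 1), g i (ω i) ∂(Pz z) = _ :=
      fun z => chain_fold (famChain hF z) n hg
    simp only [e]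
    refine ⟨i1, fun m Z h => ?_⟩
    rw [chain_fold h n hg, i2 m Z h]

/-- product of indicators of a square cylinder -/
lemma cyl_prod (s : Finset ℕ) (t : ℕ → Set S) (x : ℕ → S) :
    ((s : Set ℕ).pi t).indicator (fun _ => (1 : ℝ≥0∞)) x =
      ∏ i ∈ Finset.range (s.sup id + 1),
        (if i ∈ s then (t i).indicator (fun _ => (1 : ℝ≥0∞)) (x i) else 1) := by
  classical
  by_cases h : x ∈ (s : Set ℕ).pi t
  · rw [Set.indicator_of_mem h, Finset.prod_eq_one]
    intro i hi
    split_ifs with his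
    · rw [Set.indicator_of_mem (h i his)]
    · rfl
  · rw [Set.indicator_of_notMem h]
    simp only [Set.mem_pi, Finset.mem_coe, not_forall] at h
    obtain ⟨i, his, hi⟩ := h
    symm
    refine Finset.prod_eq_zero (i := i) ?_ ?_
    · have := Finset.le_sup (f := id) his
      simp only [id] at this
      simp only [Finset.mem_range]; omega
    · rw [if_pos his, Set.indicator_of_notMem hi]

lemma measurable_fam [MeasurableSingletonClass S] {Pz : S → Measure (ℕ → S)}
    (hF : IsMarkovFamily κ Pz) : Measurable Pz := by
  have := hF.1
  refine Measurable.measure_of_isPiSystem_of_isProbabilityMeasure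
    (generateFrom_squareCylinders (α := fun _ : ℕ => S)).symm
    (isPiSystem_squareCylinders (fun _ => MeasurableSpace.isPiSystem_measurableSet)
      (fun _ => MeasurableSet.univ)) ?_
  rintro C ⟨s, t, ht, rfl⟩
  have ht' : ∀ i, MeasurableSet (t i) := fun i => ht i trivial
  have hC : MeasurableSet ((s : Set ℕ).pi t) :=
    MeasurableSet.pi s.countable_toSet fun i _ => ht' i
  have e : ∀ z, Pz z ((s : Set ℕ).pi t) = ∫⁻ ω, ∏ i ∈ Finset.range (s.sup id + 1),
        (fun (i : ℕ) (y : S) => if i ∈ s then (t i).indicator (fun _ => (1 : ℝ≥0∞)) y else 1)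
          i (ω i) ∂(Pz z) := by
    intro z
    rw [← lintegral_indicator_one hC]
    exact lintegral_congr fun ω => cyl_prod s t ω
  simp only [e]
  refine (prod_eq (Ω' := ℕ → S) hF _ (fun (i : ℕ) (y : S) =>
    if i ∈ s then (t i).indicator (fun _ => (1 : ℝ≥0∞)) y else 1) ?_).1
  intro i
  by_cases hi : i ∈ s
  · simp only [hi, if_true]; exact measurable_const.indicator (ht' i)
  · simp only [hi, if_false]; exact measurable_const

/-- The path kernel of a Markov family. -/
noncomputable def pathK [MeasurableSingletonClass S] {Pz : S → Measure (ℕ → S)}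
    (hF : IsMarkovFamily κ Pz) : Kernel S (ℕ → S) := ⟨Pz, measurable_fam hF⟩

lemma pathK_apply [MeasurableSingletonClass S] {Pz : S → Measure (ℕ → S)}
    (hF : IsMarkovFamily κ Pz) (z : S) : pathK hF z = Pz z := rfl

instance [MeasurableSingletonClass S] {Pz : S → Measure (ℕ → S)}
    (hF : IsMarkovFamily κ Pz) : IsMarkovKernel (pathK hF) := ⟨hF.1⟩

lemma path_law [MeasurableSingletonClass S] {Pz : S → Measure (ℕ → S)}
    (hF : IsMarkovFamily κ Pz) {m : Measure Ω'} [IsFiniteMeasure m] {Z : ℕ → Ω' → S}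
    (h : IsMarkovChain m Z κ) {B : Set (ℕ → S)} (hB : MeasurableSet B) :
    m {ω | (fun k => Z k ω) ∈ B} = ∫⁻ ω, Pz (Z 0 ω) B ∂m := by
  have hmZ : Measurable fun ω k => Z k ω := measurable_pi_lambda _ h.1
  have hPm : Measurable fun ω => pathK hF (Z 0 ω) := (pathK hF).measurable.comp (h.1 0)
  have key : m.map (fun ω k => Z k ω) = m.bind (fun ω => pathK hF (Z 0 ω)) := by
    refine ext_of_generate_finite _ (generateFrom_squareCylinders (α := fun _ : ℕ => S)).symm
      (isPiSystem_squareCylinders (fun _ => MeasurableSpace.isPiSystem_measurableSet)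
      (fun _ => MeasurableSet.univ)) ?_ ?_
    · rintro C ⟨s, t, ht, rfl⟩
      have ht' : ∀ i, MeasurableSet (t i) := fun i => ht i trivial
      have hC : MeasurableSet ((s : Set ℕ).pi t) :=
        MeasurableSet.pi s.countable_toSet fun i _ => ht' i
      have hg : ∀ i : ℕ, Measurable
          ((fun (i : ℕ) (y : S) => if i ∈ s then (t i).indicator (fun _ => (1 : ℝ≥0∞)) y else 1) i) := by
        intro i
        by_cases hi : i ∈ s
        · simp only [hi, if_true]; exact measurable_const.indicator (ht' i)
        · simp only [hi, if_false]; exact measurable_const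
      have e := (prod_eq (Ω' := Ω') hF (s.sup id) _ hg).2 m Z h
      rw [Measure.map_apply hmZ hC, Measure.bind_apply hC hPm.aemeasurable,
        ← lintegral_indicator_one (hmZ hC)]
      have e1 : ∀ z, pathK hF z ((s : Set ℕ).pi t) = ∫⁻ ω, ∏ i ∈ Finset.range (s.sup id + 1),
        (fun (i : ℕ) (y : S) => if i ∈ s then (t i).indicator (fun _ => (1 : ℝ≥0∞)) y else 1)
          i (ω i) ∂(Pz z) := by
        intro z
        rw [← lintegral_indicator_one hC]
        exact lintegral_congr fun ω => cyl_prod s t ω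
      simp only [e1]
      rw [← e]
      exact lintegral_congr fun ω => cyl_prod s t (fun k => Z k ω)
    · rw [Measure.map_apply hmZ MeasurableSet.univ,
        Measure.bind_apply MeasurableSet.univ hPm.aemeasurable]
      simp
  have : (m.map (fun ω k => Z k ω)) B = (m.bind (fun ω => pathK hF (Z 0 ω))) B := by rw [key]
  rw [Measure.map_apply hmZ hB, Measure.bind_apply hB hPm.aemeasurable] at this
  exact this

/-- Markov property for path events. -/
lemma markov_path [MeasurableSingletonClass S] {Pz : S → Measure (ℕ → S)}
    (hF : IsMarkovFamily κ Pz) {m : Measure Ω'} [IsFiniteMeasure m] {Z : ℕ → Ω' → S}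
    (h : IsMarkovChain m Z κ) (n : ℕ) {C : Set Ω'} (hC : MeasurableSet[pastSig Z n] C)
    {B : Set (ℕ → S)} (hB : MeasurableSet B) :
    m ({ω | (fun k => Z (n + k) ω) ∈ B} ∩ C) = ∫⁻ ω in C, Pz (Z n ω) B ∂m := by
  have hC' : MeasurableSet C := pastSig_le h.1 n _ hC
  have h' : IsMarkovChain (m.restrict C) (fun k => Z (n + k)) κ := by
    refine ⟨fun k => h.1 _, fun k g hg D hD => ?_⟩
    have hD1 : MeasurableSet[pastSig Z (n + k)] D := by
      have : pastSig (fun k => Z (n + k)) k ≤ pastSig Z (n + k) := by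
        refine iSup₂_le fun i hi => ?_
        exact le_iSup₂_of_le (n + i) (by simp only [Set.mem_Iic] at *; omega) le_rfl
      exact this _ hD
    have hC1 : MeasurableSet[pastSig Z (n + k)] C := pastSig_mono (by omega) _ hC
    have hD' : MeasurableSet D := pastSig_le h.1 (n + k) _ hD1
    have := h.2 (n + k) g hg (D ∩ C) (MeasurableSet.inter hD1 hC1)
    rw [Measure.restrict_restrict hD']
    exact this
  have := path_law hF h' hB
  simp only [add_zero] at this
  rw [← this, Measure.restrict_apply]
  exact measurable_pi_lambda _ (fun k => h.1 (n + k)) hB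

/-- Markov property, joint functional version. -/
lemma markov_joint [MeasurableSingletonClass S] {Pz : S → Measure (ℕ → S)}
    (hF : IsMarkovFamily κ Pz) {m : Measure Ω'} [IsFiniteMeasure m] {Z : ℕ → Ω' → S}
    (h : IsMarkovChain m Z κ) (n : ℕ) {Φ : (ℕ → S) × (ℕ → S) → ℝ≥0∞} (hΦ : Measurable Φ) :
    ∫⁻ ω, Φ (fun i => Z (min i n) ω, fun k => Z (n + k) ω) ∂m =
      ∫⁻ ω, ∫⁻ ω', Φ (fun i => Z (min i n) ω, ω') ∂(Pz (Z n ω)) ∂m := by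
  have hp : Measurable fun ω => (fun i => Z (min i n) ω) := measurable_pi_lambda _ fun i => h.1 _
  have hf : Measurable fun ω => (fun k => Z (n + k) ω) := measurable_pi_lambda _ fun i => h.1 _
  let K : Kernel (ℕ → S) (ℕ → S) := (pathK hF).comap (fun p => p n) (measurable_pi_apply n)
  have key : m.map (fun ω => ((fun i => Z (min i n) ω : ℕ → S), (fun k => Z (n + k) ω : ℕ → S)))
      = (m.map (fun ω => (fun i => Z (min i n) ω : ℕ → S))) ⊗ₘ K := by
    refine Measure.ext_prod fun {s t} hs ht => ?_
    rw [Measure.map_apply (hp.prodMk hf) (hs.prod ht), Measure.compProd_apply_prod hs ht,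
      setLIntegral_map hs (K.measurable_coe ht) hp]
    have hC : MeasurableSet[pastSig Z n] ((fun ω => (fun i => Z (min i n) ω)) ⁻¹' s) := by
      have : Measurable[pastSig Z n] fun ω => (fun i => Z (min i n) ω) :=
        @measurable_pi_lambda _ _ _ (pastSig Z n) _ _
          fun i => measurable_pastSig (min_le_right i n)
      exact this hs
    have := markov_path hF h n hC ht
    simp only [K, Kernel.comap_apply, min_self, pathK_apply]
    rw [← this, Set.inter_comm]
    rfl
  rw [← lintegral_map (f := Φ) hΦ (hp.prodMk hf), key, Measure.lintegral_compProd hΦ,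
    lintegral_map _ hp]
  · simp only [K, Kernel.comap_apply, min_self, pathK_apply]
  · exact hΦ.lintegral_kernel_prod_right'

/-- one step version on the canonical space -/
lemma one_step [MeasurableSingletonClass S] {Pz : S → Measure (ℕ → S)}
    (hF : IsMarkovFamily κ Pz) (z : S) {Φ : S × (ℕ → S) → ℝ≥0∞} (hΦ : Measurable Φ) :
    ∫⁻ ω, Φ (ω 0, fun k => ω (k + 1)) ∂(Pz z) = ∫⁻ z', ∫⁻ ω', Φ (z, ω') ∂(Pz z') ∂(κ z) := by
  have := hF.1 z
  have h1 := markov_joint hF (famChain hF z) 1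
    (Φ := fun p => Φ (p.1 0, p.2)) (by fun_prop)
  simp only [Nat.min_eq_left (Nat.zero_le 1)] at h1
  simp only [add_comm _ 1]
  rw [h1]
  have h2 : Measurable fun z' => ∫⁻ ω', Φ (z, ω') ∂(Pz z') :=
    Measurable.lintegral_kernel (κ := pathK hF) (by fun_prop)
  have h3 := markov_fun (famChain hF z) 0 h2 (ξ := fun _ => 1) measurable_const
  simp only [one_mul, zero_add] at h3
  rw [lintegral_congr_ae (g := fun ω => ∫⁻ ω', Φ (z, ω') ∂(Pz (ω 1))), h3,
    lintegral_congr_ae (g := fun ω => ∫⁻ z', ∫⁻ ω', Φ (z, ω') ∂(Pz z') ∂(κ z))]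
  · simp
  · filter_upwards [fam_zero hF z] with ω hω
    rw [hω]
  · filter_upwards [fam_zero hF z] with ω hω
    rw [hω]

end GeneralMarkov

section Ergodic

/-- Maximal ergodic theorem (Garsia), in the form needed here. -/
lemma max_ergodic {Ω' : Type*} [MeasurableSpace Ω'] {m : Measure Ω'} [IsProbabilityMeasure m]
    {T : Ω' → Ω'} (hT : MeasurePreserving T m m) {g : Ω' → ℝ} (hg : Measurable g)
    {b : ℝ} (hb : ∀ ω, |g ω| ≤ b) {S : ℕ → Ω' → ℝ} (hS0 : ∀ ω, S 0 ω = 0)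
    (hS : ∀ n ω, S (n + 1) ω = g ω + S n (T ω)) (hpos : ∀ᵐ ω ∂m, ∃ n, 0 < S n ω) :
    0 ≤ ∫ ω, g ω ∂m := by
  let M : ℕ → Ω' → ℝ := fun n => Nat.rec (fun _ => 0) (fun _ f ω => max 0 (g ω + f (T ω))) n
  have M0 : ∀ ω, M 0 ω = 0 := fun _ => rfl
  have Ms : ∀ n ω, M (n + 1) ω = max 0 (g ω + M n (T ω)) := fun _ _ => rfl
  have Mnn : ∀ n ω, 0 ≤ M n ω := by
    intro n ω
    cases n with
    | zero => rw [M0]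
    | succ n => rw [Ms]; exact le_max_left _ _
  have Mmeas : ∀ n, Measurable (M n) := by
    intro n
    induction n with
    | zero => exact measurable_const
    | succ n ih => exact measurable_const.max (hg.add (ih.comp hT.measurable))
  have Mbd : ∀ n ω, M n ω ≤ n * b := by
    intro n
    induction n with
    | zero => intro ω; rw [M0]; simp
    | succ n ih =>
      intro ω
      have h1 := hb ω
      have h2 := ih (T ω)
      have h3 := abs_le.1 h1
      have h4 := abs_nonneg (g ω)
      have h5 : (0 : ℝ) ≤ n := Nat.cast_nonneg n
      rw [Ms]
      push_cast
      refine max_le (by nlinarith) (by nlinarith)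
  have Mmono : ∀ n ω, M n ω ≤ M (n + 1) ω := by
    intro n
    induction n with
    | zero => intro ω; rw [M0]; exact Mnn (0 + 1) ω
    | succ n ih =>
      intro ω
      rw [Ms, Ms (n + 1)]
      exact max_le_max le_rfl (by linarith [ih (T ω)])
  have SM : ∀ n ω, S n ω ≤ M n ω := by
    intro n
    induction n with
    | zero => intro ω; rw [hS0, M0]
    | succ n ih =>
      intro ω
      rw [hS, Ms]
      exact le_max_of_le_right (by linarith [ih (T ω)])
  have Mint : ∀ n, Integrable (M n) m := by
    intro n
    refine Integrable.of_bound (Mmeas n).aestronglyMeasurable (n * b) (ae_of_all _ fun ω => ?_)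
    rw [Real.norm_eq_abs, abs_of_nonneg (Mnn n ω)]
    exact Mbd n ω
  have gint : Integrable g m :=
    Integrable.of_bound hg.aestronglyMeasurable b (ae_of_all _ fun ω => hb ω)
  let B : ℕ → Set Ω' := fun n => {ω | 0 < M n ω}
  have Bmeas : ∀ n, MeasurableSet (B n) := fun n => measurableSet_lt measurable_const (Mmeas n)
  have hB : ∀ n, 0 ≤ ∫ ω, (B n).indicator g ω ∂m := by
    intro n
    cases n with
    | zero =>
      have : ∀ ω, (B 0).indicator g ω = 0 := by
        intro ω
        apply Set.indicator_of_notMem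
        simp [B, M0]
      simp [this]
    | succ n =>
      have hle : ∀ ω, M (n + 1) ω - M n (T ω) ≤ (B (n + 1)).indicator g ω := by
        intro ω
        by_cases h : ω ∈ B (n + 1)
        · rw [Set.indicator_of_mem h]
          have h' : 0 < M (n + 1) ω := h
          rw [Ms] at h' ⊢
          rcases max_cases 0 (g ω + M n (T ω)) with ⟨h1, _⟩ | ⟨h1, _⟩
          · rw [h1] at h'; exact absurd h' (lt_irrefl _)
          · rw [h1]; linarith
        · rw [Set.indicator_of_notMem h]
          have h' : M (n + 1) ω ≤ 0 := not_lt.1 h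
          linarith [Mnn n (T ω)]
      have hTint : Integrable (fun ω => M n (T ω)) m := (hT.integrable_comp_of_integrable (Mint n))
      have e : ∫ ω, M n (T ω) ∂m = ∫ ω, M n ω ∂m := by
        conv_rhs => rw [← hT.map_eq]
        rw [integral_map hT.measurable.aemeasurable (Mmeas n).aestronglyMeasurable]
      have h1 : ∫ ω, (M (n + 1) ω - M n (T ω)) ∂m ≤ ∫ ω, (B (n + 1)).indicator g ω ∂m :=
        integral_mono ((Mint (n + 1)).sub hTint) (gint.indicator (Bmeas (n + 1))) hle
      rw [integral_sub (Mint (n + 1)) hTint, e] at h1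
      have h2 : ∫ ω, M n ω ∂m ≤ ∫ ω, M (n + 1) ω ∂m :=
        integral_mono (Mint n) (Mint (n + 1)) (Mmono n)
      linarith
  have hlim : Filter.Tendsto (fun n => ∫ ω, (B n).indicator g ω ∂m) Filter.atTop
      (nhds (∫ ω, g ω ∂m)) := by
    refine tendsto_integral_of_dominated_convergence (fun _ => b)
      (fun n => (hg.indicator (Bmeas n)).aestronglyMeasurable) (integrable_const b) ?_ ?_
    · intro n
      refine ae_of_all _ fun ω => ?_
      refine (norm_indicator_le_norm_self g ω).trans ?_
      exact hb ω
    · filter_upwards [hpos] with ω hω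
      obtain ⟨n, hn⟩ := hω
      refine tendsto_const_nhds.congr' ?_
      filter_upwards [Filter.eventually_ge_atTop n] with k hk
      rw [Set.indicator_of_mem]
      have : M n ω ≤ M k ω := monotone_nat_of_le_succ (f := fun n => M n ω) (fun n => Mmono n ω) hk
      exact lt_of_lt_of_le (lt_of_lt_of_le hn (SM n ω)) this
  exact ge_of_tendsto' hlim hB

variable {S : Type*} [MeasurableSpace S] {κ : Kernel S S}

/-- Number of times `k < n` such that the path shifted by `k` is in `U`. -/
noncomputable def cnt (U : Set (ℕ → S)) (n : ℕ) (ω : ℕ → S) : ℝ :=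
  ∑ k ∈ Finset.range n, U.indicator (fun _ => (1 : ℝ)) (fun i => ω (k + i))

lemma cnt_succ (U : Set (ℕ → S)) (n : ℕ) (ω : ℕ → S) :
    cnt U (n + 1) ω = U.indicator (fun _ => (1 : ℝ)) ω + cnt U n (fun i => ω (i + 1)) := by
  unfold cnt
  rw [Finset.sum_range_succ', add_comm]
  congr 1
  · congr 1; funext i; simp
  · refine Finset.sum_congr rfl fun k _ => ?_
    congr 1; funext i; congr 1; omega

lemma measurable_shift (k : ℕ) : Measurable fun (ω : ℕ → S) => (fun i => ω (k + i) : ℕ → S) :=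
  measurable_pi_lambda _ fun _ => measurable_pi_apply _

lemma measurable_cnt {U : Set (ℕ → S)} (hU : MeasurableSet U) (n : ℕ) :
    Measurable (cnt U n) :=
  Finset.measurable_fun_sum _ fun k _ =>
    (measurable_const.indicator hU).comp (measurable_shift k)

/-- Event that the counts grow linearly. -/
def linEv (U : Set (ℕ → S)) (c : ℝ) : Set (ℕ → S) :=
  {ω | ∃ K : ℕ, ∀ n : ℕ, c * n ≤ cnt U n ω + K}

lemma measurableSet_linEv {U : Set (ℕ → S)} (hU : MeasurableSet U) (c : ℝ) :
    MeasurableSet (linEv U c) := by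
  have : linEv U c = ⋃ K : ℕ, ⋂ n : ℕ, {ω | c * n ≤ cnt U n ω + K} := by
    ext ω; simp [linEv]
  rw [this]
  exact MeasurableSet.iUnion fun K => MeasurableSet.iInter fun n =>
    measurableSet_le measurable_const ((measurable_cnt hU n).add measurable_const)

lemma linEv_shift (U : Set (ℕ → S)) {c : ℝ} (hc0 : 0 ≤ c) (hc1 : c ≤ 1) (ω : ℕ → S) :
    (fun i => ω (i + 1)) ∈ linEv U c ↔ ω ∈ linEv U c := by
  have h01 : U.indicator (fun _ => (1 : ℝ)) ω ≤ 1 := by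
    by_cases h : ω ∈ U <;> simp [h]
  have h00 : 0 ≤ U.indicator (fun _ => (1 : ℝ)) ω := by
    by_cases h : ω ∈ U <;> simp [h]
  constructor
  · rintro ⟨K, hK⟩
    refine ⟨K + 1, fun n => ?_⟩
    cases n with
    | zero => simp [cnt]; positivity
    | succ n =>
      have := hK n
      rw [cnt_succ]; push_cast; linarith
  · rintro ⟨K, hK⟩
    refine ⟨K + 1, fun n => ?_⟩
    have := hK (n + 1)
    rw [cnt_succ] at this; push_cast at this ⊢; linarith

lemma linEv_shift' (U : Set (ℕ → S)) {c : ℝ} (hc0 : 0 ≤ c) (hc1 : c ≤ 1) (n : ℕ) :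
    ∀ ω : ℕ → S, (fun i => ω (n + i)) ∈ linEv U c ↔ ω ∈ linEv U c := by
  induction n with
  | zero => intro ω; simp
  | succ n ih =>
    intro ω
    rw [← ih ω, ← linEv_shift U hc0 hc1 (fun i => ω (n + i))]
    have : (fun i => ω (n + 1 + i)) = fun i => ω (n + (i + 1)) := by
      funext i; congr 1; omega
    rw [this]

/-- Canonical filtration. -/
def canonFil : Filtration ℕ (inferInstance : MeasurableSpace (ℕ → S)) where
  seq n := pastSig (fun k (ω : ℕ → S) => ω k) n
  mono' _ _ h := pastSig_mono h
  le' n := pastSig_le (fun k => measurable_pi_apply k) n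

lemma iSup_canonFil : (⨆ n, (canonFil (S := S)) n) = (inferInstance : MeasurableSpace (ℕ → S)) := by
  apply le_antisymm
  · exact iSup_le fun n => canonFil.le n
  · refine iSup_le fun i => ?_
    refine le_iSup_of_le i ?_
    exact le_iSup₂_of_le (f := fun i (_ : i ∈ Set.Iic _) =>
      MeasurableSpace.comap (fun ω : ℕ → S => ω i) inferInstance) i (Set.mem_Iic.2 le_rfl) le_rfl

lemma levy_harmonic [MeasurableSingletonClass S] {Pz : S → Measure (ℕ → S)}
    (hF : IsMarkovFamily κ Pz) {V : Set (ℕ → S)} (hV : MeasurableSet V)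
    (hinv : ∀ (n : ℕ) (ω : ℕ → S), (fun i => ω (n + i)) ∈ V ↔ ω ∈ V) (z : S) :
    ∀ᵐ ω ∂(Pz z), Filter.Tendsto (fun n => (Pz (ω n)).real V) Filter.atTop
      (nhds (V.indicator (fun _ => (1 : ℝ)) ω)) := by
  have := hF.1 z
  have hPV : Measurable fun z => (Pz z).real V :=
    ((pathK hF).measurable_coe hV).ennreal_toReal
  have h_integrable : Integrable (V.indicator (fun _ => (1 : ℝ))) (Pz z) :=
    (integrable_const 1).indicator hV
  have h1 := h_integrable.tendsto_ae_condExp (ℱ := canonFil) (by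
    rw [iSup_canonFil]
    exact (measurable_const.indicator hV).stronglyMeasurable)
  have h2 : ∀ n, (fun ω : ℕ → S => (Pz (ω n)).real V) =ᵐ[Pz z]
      (Pz z)[V.indicator (fun _ => (1 : ℝ)) | canonFil n] := by
    intro n
    have hmn : Measurable[canonFil n] fun ω : ℕ → S => (Pz (ω n)).real V :=
      hPV.comp (measurable_pastSig (Z := fun k (ω : ℕ → S) => ω k) le_rfl)
    have hbd : Integrable (fun ω : ℕ → S => (Pz (ω n)).real V) (Pz z) := by
      refine Integrable.of_bound (hPV.comp (measurable_pi_apply n)).aestronglyMeasurable 1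
        (ae_of_all _ fun ω => ?_)
      have := hF.1 (ω n)
      rw [Real.norm_eq_abs, abs_of_nonneg measureReal_nonneg]
      exact measureReal_le_one
    refine ae_eq_condExp_of_forall_setIntegral_eq (canonFil.le n) h_integrable
      (fun s _ _ => hbd.integrableOn) (fun C hC _ => ?_) hmn.aestronglyMeasurable
    have hC' : MeasurableSet C := canonFil.le n _ hC
    have h3 := markov_path hF (famChain hF z) n hC hV
    have h4 : {ω : ℕ → S | (fun k => ω (n + k)) ∈ V} = V := by
      ext ω; exact hinv n ω
    rw [h4] at h3
    rw [integral_indicator hV, Measure.restrict_restrict hV]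
    simp only [integral_const, smul_eq_mul, mul_one, measureReal_restrict_apply_univ]
    rw [measureReal_def, h3]
    simp only [measureReal_def]
    refine integral_toReal ?_ ?_
    · exact (((pathK hF).measurable_coe hV).comp (measurable_pi_apply n)).aemeasurable
    · refine ae_of_all _ fun ω => ?_
      have := hF.1 (ω n)
      exact measure_lt_top _ _
  filter_upwards [h1, ae_all_iff.2 h2] with ω h3 h4
  exact h3.congr fun n => (h4 n).symm

lemma zero_one [MeasurableSingletonClass S] {Pz : S → Measure (ℕ → S)} {ψ : Measure S}
    (hF : IsMarkovFamily κ Pz) (hH : HarrisProp κ Pz ψ) (hψ : ψ ≠ 0)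
    {V : Set (ℕ → S)} (hV : MeasurableSet V)
    (hinv : ∀ (n : ℕ) (ω : ℕ → S), (fun i => ω (n + i)) ∈ V ↔ ω ∈ V) {z0 : S}
    (hz0 : 0 < Pz z0 V) : ∀ z, ∀ᵐ ω ∂(Pz z), ω ∈ V := by
  have hPV : Measurable fun z => (Pz z).real V :=
    ((pathK hF).measurable_coe hV).ennreal_toReal
  have hA : MeasurableSet {z | 1 / 2 < (Pz z).real V} := measurableSet_lt measurable_const hPV
  have vis : ∀ A : Set S, MeasurableSet A → 0 < ψ A → ∀ z, ∀ᵐ ω ∂(Pz z),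
      ∀ N : ℕ, ∃ k : ℕ, N ≤ k ∧ ω k ∈ A := by
    intro A hA hpos z
    have := hF.1 z
    have hm : MeasurableSet {ω : ℕ → S | ∀ N : ℕ, ∃ k : ℕ, N ≤ k ∧ ω k ∈ A} := by
      have : {ω : ℕ → S | ∀ N : ℕ, ∃ k : ℕ, N ≤ k ∧ ω k ∈ A} =
          ⋂ N : ℕ, ⋃ k : ℕ, ⋃ _ : N ≤ k, (fun ω : ℕ → S => ω k) ⁻¹' A := by
        ext ω; simp
      rw [this]
      exact MeasurableSet.iInter fun N => MeasurableSet.iUnion fun k => MeasurableSet.iUnion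
        fun _ => measurable_pi_apply k hA
    exact (mem_ae_iff_prob_eq_one hm).2 (hH A hA hpos z)
  by_cases h : 0 < ψ {z | 1 / 2 < (Pz z).real V}
  · intro z
    filter_upwards [vis _ hA h z, levy_harmonic hF hV hinv z] with ω h1 h2
    by_contra hω
    rw [Set.indicator_of_notMem hω] at h2
    have := h2.eventually (gt_mem_nhds (show (0 : ℝ) < 1 / 2 by norm_num))
    obtain ⟨N, hN⟩ := Filter.eventually_atTop.1 this
    obtain ⟨k, hk, hk'⟩ := h1 N
    exact lt_asymm (hN k hk) hk'
  · exfalso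
    have hc : 0 < ψ {z | 1 / 2 < (Pz z).real V}ᶜ := by
      rw [pos_iff_ne_zero]
      intro h0
      have h' : ψ {z | 1 / 2 < (Pz z).real V} = 0 := by simpa using h
      apply hψ
      rw [← Measure.measure_univ_eq_zero, ← Set.union_compl_self {z | 1 / 2 < (Pz z).real V}]
      exact measure_union_null h' h0
    have : ∀ᵐ ω ∂(Pz z0), ω ∉ V := by
      filter_upwards [vis _ hA.compl hc z0, levy_harmonic hF hV hinv z0] with ω h1 h2
      intro hω
      rw [Set.indicator_of_mem hω] at h2
      have := h2.eventually (lt_mem_nhds (show (1 / 2 : ℝ) < 1 by norm_num))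
      obtain ⟨N, hN⟩ := Filter.eventually_atTop.1 this
      obtain ⟨k, hk, hk'⟩ := h1 N
      exact hk' (hN k hk)
    have h0 : Pz z0 V = 0 := by
      rw [← compl_compl V]; exact this
    exact hz0.ne' h0

lemma linear_growth [MeasurableSingletonClass S] {Pz : S → Measure (ℕ → S)} {ψ : Measure S}
    (hF : IsMarkovFamily κ Pz) (hH : HarrisProp κ Pz ψ) (hP : IsPositive κ)
    {U : Set (ℕ → S)} (hU : MeasurableSet U) {B : Set S} (hB : MeasurableSet B)
    (hψB : 0 < ψ B) (hBU : ∀ z ∈ B, 0 < Pz z U) :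
    ∃ c : ℝ, 0 < c ∧ c ≤ 1 ∧ ∀ z, ∀ᵐ ω ∂(Pz z), ω ∈ linEv U c := by
  obtain ⟨π, hπ, hinv⟩ := hP
  let m : Measure (ℕ → S) := π.bind (pathK hF)
  have hm_apply : ∀ {V : Set (ℕ → S)}, MeasurableSet V → m V = ∫⁻ z, Pz z V ∂π := fun hV =>
    Measure.bind_apply hV (pathK hF).measurable.aemeasurable
  have hmprob : IsProbabilityMeasure m := by
    constructor
    rw [hm_apply MeasurableSet.univ]
    have : ∀ z, Pz z Set.univ = 1 := fun z => (hF.1 z).measure_univ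
    simp [this]
  have hTm : Measurable fun (ω : ℕ → S) => (fun i => ω (i + 1) : ℕ → S) :=
    measurable_pi_lambda _ fun _ => measurable_pi_apply _
  have hT : MeasurePreserving (fun (ω : ℕ → S) => (fun i => ω (i + 1) : ℕ → S)) m m := by
    refine ⟨hTm, ?_⟩
    ext V hV
    rw [Measure.map_apply hTm hV, hm_apply (hTm hV), hm_apply hV]
    have h1 : ∀ z, Pz z ((fun (ω : ℕ → S) => (fun i => ω (i + 1) : ℕ → S)) ⁻¹' V)
        = ∫⁻ z', Pz z' V ∂(κ z) := by
      intro z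
      have := one_step hF z (Φ := fun p => V.indicator (fun _ => 1) p.2)
        ((measurable_const.indicator hV).comp measurable_snd)
      rw [← lintegral_indicator_one (hTm hV)]
      refine Eq.trans this ?_
      refine lintegral_congr fun z' => ?_
      exact lintegral_indicator_one hV
    simp only [h1]
    have h2 := Measure.lintegral_bind (m := π) (μ := fun z => κ z) (f := fun z => Pz z V)
      κ.measurable.aemeasurable ((pathK hF).measurable_coe hV).aemeasurable
    rw [← h2, hinv]
  -- `π B > 0`
  have hmap : ∀ k : ℕ, m ((fun ω : ℕ → S => ω k) ⁻¹' B) = m ((fun ω : ℕ → S => ω 0) ⁻¹' B) := by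
    intro k
    induction k with
    | zero => rfl
    | succ k ih =>
      rw [← ih, ← hT.measure_preimage ((measurable_pi_apply k hB)).nullMeasurableSet]
      rfl
  have hm0 : m ((fun ω : ℕ → S => ω 0) ⁻¹' B) = π B := by
    rw [hm_apply (measurable_pi_apply 0 hB), ← lintegral_indicator_one hB]
    refine lintegral_congr fun z => ?_
    have := hF.1 z
    by_cases hz : z ∈ B
    · rw [Set.indicator_of_mem hz]
      refine (prob_compl_eq_zero_iff (measurable_pi_apply 0 hB)).1 ?_
      have := fam_zero hF z
      refine measure_mono_null ?_ this
      intro ω hω h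
      exact hω (by simp only [Set.mem_preimage]; rw [h]; exact hz)
    · rw [Set.indicator_of_notMem hz]
      have := fam_zero hF z
      refine measure_mono_null ?_ this
      intro ω hω h
      simp only [Set.mem_preimage] at hω
      rw [h] at hω
      exact hz hω
  have hπB : 0 < π B := by
    rw [pos_iff_ne_zero]
    intro h0
    have h1 : m (⋃ k : ℕ, (fun ω : ℕ → S => ω k) ⁻¹' B) = 0 := by
      rw [measure_iUnion_null_iff]
      intro k; rw [hmap, hm0, h0]
    have hmeas : MeasurableSet (⋃ k : ℕ, (fun ω : ℕ → S => ω k) ⁻¹' B) :=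
      MeasurableSet.iUnion fun k => measurable_pi_apply k hB
    have h2 : ∀ z, Pz z (⋃ k : ℕ, (fun ω : ℕ → S => ω k) ⁻¹' B) = 1 := by
      intro z
      have := hF.1 z
      refine le_antisymm prob_le_one ?_
      rw [← hH B hB hψB z]
      refine measure_mono fun ω hω => ?_
      obtain ⟨k, _, hk⟩ := hω 0
      exact Set.mem_iUnion.2 ⟨k, hk⟩
    rw [hm_apply hmeas] at h1
    simp [h2] at h1
  have hmU : 0 < m U := by
    rw [hm_apply hU, pos_iff_ne_zero]
    intro h0
    have h0 := (lintegral_eq_zero_iff ((pathK hF).measurable_coe hU)).1 h0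
    have : π B = 0 := by
      refine measure_mono_null ?_ h0
      intro z hz h
      exact (hBU z hz).ne' h
    exact hπB.ne' this
  have hmU' : 0 < m.real U := ENNReal.toReal_pos hmU.ne' (measure_ne_top _ _)
  have hmU1 : m.real U ≤ 1 := measureReal_le_one
  set c : ℝ := m.real U / 2 with hc
  have hc0 : 0 < c := by positivity
  have hc1 : c ≤ 1 := by linarith
  refine ⟨c, hc0, hc1, ?_⟩
  have hEm := measurableSet_linEv hU c
  have hEpos : 0 < m (linEv U c) := by
    by_contra hcon
    have hE0 : m (linEv U c) = 0 := by simpa using hcon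
    have hE0' : ∀ᵐ ω ∂m, ω ∉ linEv U c := by
      rw [ae_iff]; simpa using hE0
    have hind : Integrable (U.indicator (fun _ => (1 : ℝ))) m :=
      (integrable_const (1 : ℝ)).indicator hU
    have := max_ergodic hT (g := fun ω => c - U.indicator (fun _ => (1 : ℝ)) ω)
      (measurable_const.sub (measurable_const.indicator hU)) (b := 1) (fun ω => by
        by_cases h : ω ∈ U
        · simp only [h, Set.indicator_of_mem]; rw [abs_le]; constructor <;> linarith
        · simp only [h, not_false_eq_true, Set.indicator_of_notMem]
          rw [abs_le]; constructor <;> linarith)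
      (S := fun n ω => c * n - cnt U n ω) (fun ω => by simp [cnt])
      (fun n ω => by rw [cnt_succ]; push_cast; ring) (by
        filter_upwards [hE0'] with ω hω
        by_contra h
        push Not at h
        exact hω ⟨0, fun n => by have := h n; push_cast; linarith⟩)
    rw [integral_sub (integrable_const _) hind, integral_indicator hU] at this
    simp at this
    linarith
  have : ∃ z0, 0 < Pz z0 (linEv U c) := by
    by_contra h
    push Not at h
    rw [hm_apply hEm] at hEpos
    have h' : ∀ z, Pz z (linEv U c) = 0 := fun z => by simpa using h z
    simp [h'] at hEpos
  obtain ⟨z0, hz0⟩ := this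
  have hψ : ψ ≠ 0 := by rintro rfl; simp at hψB
  exact zero_one hF hH hψ hEm (fun n ω => linEv_shift' U hc0.le hc1 n ω) hz0

end Ergodic

section Densities

lemma lintegral_pi_succ {μ : Measure 𝓧} [SigmaFinite μ] {R : ℕ} {f : (Fin (R + 1) → 𝓧) → ℝ≥0∞}
    (hf : Measurable f) :
    ∫⁻ x, f x ∂(Measure.pi fun _ : Fin (R + 1) => μ) =
      ∫⁻ x0, ∫⁻ xr, f (Fin.cons x0 xr) ∂(Measure.pi fun _ : Fin R => μ) ∂μ := by
  have h := (measurePreserving_piFinSuccAbove (fun _ : Fin (R + 1) => μ) 0).symm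
  rw [← h.lintegral_comp hf, lintegral_prod]
  · simp [MeasurableEquiv.piFinSuccAbove_symm_apply]
    rfl
  · exact (hf.comp h.measurable).aemeasurable


lemma lintegral_kappa {κ : Kernel (𝓧 × 𝓨) (𝓧 × 𝓨)} {μ : Measure 𝓧} [SigmaFinite μ]
    {q : 𝓧 × 𝓨 → 𝓧 × 𝓨 → ℝ≥0∞} (hq : Measurable (Function.uncurry q))
    (hκ : ∀ z : 𝓧 × 𝓨, (κ z : Measure (𝓧 × 𝓨)) =
      (μ.prod Measure.count).withDensity (fun z' => q z' z)) (z : 𝓧 × 𝓨)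
    {f : 𝓧 × 𝓨 → ℝ≥0∞} (hf : Measurable f) :
    ∫⁻ z', f z' ∂(κ z) = ∫⁻ x, ∑ i : 𝓨, q (x, i) z * f (x, i) ∂μ := by
  have hqz : Measurable fun z' => q z' z := hq.comp (measurable_id.prodMk measurable_const)
  rw [hκ z, lintegral_withDensity_eq_lintegral_mul _ hqz hf, lintegral_prod _ (hqz.mul hf).aemeasurable]
  refine lintegral_congr fun x => ?_
  rw [lintegral_count, tsum_fintype]
  rfl

lemma measurable_pijD {q : 𝓧 × 𝓨 → 𝓧 × 𝓨 → ℝ≥0∞} (hq : Measurable (Function.uncurry q))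
    {R : ℕ} (i j : 𝓨) : Measurable fun x : Fin (R + 1) → 𝓧 => pijD q x i j := by
  unfold pijD
  refine Finset.measurable_fun_sum _ fun y _ => ?_
  by_cases h : y 0 = i ∧ y (Fin.last R) = j
  · simp only [h, and_self, if_true]
    refine Finset.measurable_fun_prod _ fun k _ => ?_
    have : Measurable fun x : Fin (R + 1) → 𝓧 =>
        (((x k.succ, y k.succ), (x k.castSucc, y k.castSucc)) : (𝓧 × 𝓨) × (𝓧 × 𝓨)) := by
      fun_prop
    exact hq.comp this
  · simp only [h, if_false]; exact measurable_const

lemma pijD_zero (q : 𝓧 × 𝓨 → 𝓧 × 𝓨 → ℝ≥0∞) (x : Fin (0 + 1) → 𝓧) (i j : 𝓨) :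
    pijD q x i j = if i = j then 1 else 0 := by
  unfold pijD
  haveI : Unique (Fin (0 + 1)) := inferInstanceAs (Unique (Fin 1))
  rw [← (Equiv.funUnique (Fin (0 + 1)) 𝓨).symm.sum_comp]
  simp only [Finset.univ_eq_empty, Finset.prod_empty]
  by_cases h : i = j
  · subst h
    rw [Finset.sum_eq_single i] <;> simp [Equiv.funUnique]
  · rw [if_neg h]
    refine Finset.sum_eq_zero fun y _ => ?_
    rw [if_neg]
    rintro ⟨h1, h2⟩
    simp [Equiv.funUnique] at h1 h2
    exact h (h1.symm.trans h2)

lemma pijD_succ (q : 𝓧 × 𝓨 → 𝓧 × 𝓨 → ℝ≥0∞) {R : ℕ} (x0 : 𝓧) (x : Fin (R + 1) → 𝓧) (i j : 𝓨) :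
    pijD q (Fin.cons x0 x : Fin (R + 1 + 1) → 𝓧) i j =
      ∑ i' : 𝓨, q (x 0, i') (x0, i) * pijD q x i' j := by
  unfold pijD
  rw [← (Fin.consEquiv (fun _ : Fin (R + 2) => 𝓨)).sum_comp, Fintype.sum_prod_type,
    Finset.sum_eq_single i]
  · simp only [Finset.mul_sum]
    rw [Finset.sum_comm]
    refine Finset.sum_congr rfl fun y _ => ?_
    rw [Finset.sum_eq_single (y 0)]
    · simp only [Fin.consEquiv_apply, Fin.cons_zero, true_and]
      rw [← Fin.succ_last, Fin.cons_succ, Fin.prod_univ_succ]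
      by_cases h : y (Fin.last R) = j
      · simp only [h, if_true, Fin.cons_succ, Fin.castSucc_zero, Fin.cons_zero, ← Fin.succ_castSucc]
      · simp [h]
    · intro b _ hb
      rw [if_neg (fun h => hb h.1.symm), mul_zero]
    · simp
  · intro b _ hb
    refine Finset.sum_eq_zero fun y _ => ?_
    rw [if_neg]
    rintro ⟨h1, _⟩
    exact hb (by simpa using h1)
  · simp

/-- Joint density of the observations `X_{1:R}` and the state `Y_R` from a given start. -/
lemma dens [MeasurableSingletonClass 𝓧] {κ : Kernel (𝓧 × 𝓨) (𝓧 × 𝓨)} {μ : Measure 𝓧} [SigmaFinite μ]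
    {q : 𝓧 × 𝓨 → 𝓧 × 𝓨 → ℝ≥0∞} (hq : Measurable (Function.uncurry q))
    (hκ : ∀ z : 𝓧 × 𝓨, (κ z : Measure (𝓧 × 𝓨)) =
      (μ.prod Measure.count).withDensity (fun z' => q z' z))
    {Pz : 𝓧 × 𝓨 → Measure (ℕ → 𝓧 × 𝓨)} (hF : IsMarkovFamily κ Pz) (R : ℕ) :
    ∀ (Ψ : (Fin (R + 1) → 𝓧) × 𝓨 → ℝ≥0∞), Measurable Ψ → ∀ z : 𝓧 × 𝓨,
    ∫⁻ ω, Ψ (fun k : Fin (R + 1) => (ω k).1, (ω R).2) ∂(Pz z) =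
      ∫⁻ xr, ∑ j : 𝓨, pijD q (Fin.cons z.1 xr : Fin (R + 1) → 𝓧) z.2 j *
        Ψ (Fin.cons z.1 xr, j) ∂(Measure.pi fun _ : Fin R => μ) := by
  induction R with
  | zero =>
    intro Ψ hΨ z
    have := hF.1 z
    rw [Measure.pi_of_empty, lintegral_dirac]
    simp only [pijD_zero, ite_mul, one_mul, zero_mul, Finset.sum_ite_eq, Finset.mem_univ, if_true]
    rw [lintegral_congr_ae (g := fun _ => Ψ (Fin.cons z.1 (fun a => isEmptyElim a), z.2))]
    · simp
    · filter_upwards [fam_zero hF z] with ω hω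
      have : (fun k : Fin (0 + 1) => (ω k).1) = Fin.cons z.1 (fun a => isEmptyElim a) := by
        funext k
        have : k = 0 := Fin.ext (by omega)
        subst this
        simp [hω]
      rw [this, hω]
  | succ R ih =>
    intro Ψ hΨ z
    have hc : Measurable fun p : 𝓧 × (Fin (R + 1) → 𝓧) =>
        (Fin.cons p.1 p.2 : Fin (R + 1 + 1) → 𝓧) := by
      refine measurable_pi_lambda _ fun k => ?_
      refine Fin.cases ?_ (fun k => ?_) k
      · simpa using measurable_fst
      · simp only [Fin.cons_succ]; fun_prop
    have hcr : ∀ x0 : 𝓧, Measurable fun p : (Fin R → 𝓧) =>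
        (Fin.cons x0 p : Fin (R + 1) → 𝓧) := by
      intro x0
      refine measurable_pi_lambda _ fun k => ?_
      refine Fin.cases ?_ (fun k => ?_) k
      · simp
      · simp only [Fin.cons_succ]; fun_prop
    have h1 := one_step hF z (Φ := fun p =>
      Ψ (Fin.cons p.1.1 (fun k : Fin (R + 1) => (p.2 k).1), (p.2 R).2)) (by
        refine hΨ.comp (Measurable.prodMk ?_ (by fun_prop))
        have : Measurable fun p : (𝓧 × 𝓨) × (ℕ → 𝓧 × 𝓨) =>
          ((p.1.1, fun k : Fin (R + 1) => (p.2 k).1) : 𝓧 × (Fin (R + 1) → 𝓧)) := by fun_prop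
        exact hc.comp this)
    have h2 : ∀ ω : ℕ → 𝓧 × 𝓨, Ψ (fun k : Fin (R + 1 + 1) => (ω k).1, (ω (R + 1)).2) =
        Ψ (Fin.cons (ω 0).1 (fun k : Fin (R + 1) => (ω (k + 1)).1), (ω (R + 1)).2) := by
      intro ω
      congr 2
      funext k
      refine Fin.cases ?_ (fun k => ?_) k
      · simp
      · simp
    simp only [h2]
    refine h1.trans ?_
    have h3 : Measurable fun p : (Fin (R + 1) → 𝓧) × 𝓨 => Ψ (Fin.cons z.1 p.1, p.2) :=
      hΨ.comp ((hc.comp (measurable_const.prodMk measurable_fst)).prodMk measurable_snd)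
    have h4 : ∀ z', ∫⁻ ω', Ψ (Fin.cons z.1 (fun k : Fin (R + 1) => (ω' k).1), (ω' R).2) ∂(Pz z')
        = _ := fun z' => ih (fun p => Ψ (Fin.cons z.1 p.1, p.2)) h3 z'
    have h5 : Measurable fun z' => ∫⁻ ω', Ψ (Fin.cons z.1 (fun k : Fin (R + 1) => (ω' k).1), (ω' R).2) ∂(Pz z') := by
      refine Measurable.lintegral_kernel (κ := pathK hF) ?_
      exact h3.comp (Measurable.prodMk (by fun_prop) (by fun_prop))
    rw [lintegral_kappa hq hκ z h5]
    simp only [h4]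
    have h6 : Measurable fun xr : Fin (R + 1) → 𝓧 =>
        ∑ j : 𝓨, pijD q (Fin.cons z.1 xr : Fin (R + 1 + 1) → 𝓧) z.2 j * Ψ (Fin.cons z.1 xr, j) := by
      refine Finset.measurable_fun_sum _ fun j _ => Measurable.mul ?_ ?_
      · exact (measurable_pijD hq _ _).comp (hc.comp (measurable_const.prodMk measurable_id))
      · exact h3.comp (measurable_id.prodMk measurable_const)
    rw [lintegral_pi_succ h6]
    refine lintegral_congr fun x0 => ?_
    have h7 : ∀ i : 𝓨, Measurable fun xr : Fin R → 𝓧 =>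
        ∑ j : 𝓨, pijD q (Fin.cons x0 xr : Fin (R + 1) → 𝓧) i j *
          Ψ (Fin.cons z.1 (Fin.cons x0 xr : Fin (R + 1) → 𝓧), j) := by
      intro i
      refine Finset.measurable_fun_sum _ fun j _ => Measurable.mul ?_ ?_
      · exact (measurable_pijD hq _ _).comp (hcr x0)
      · exact h3.comp ((hcr x0).prodMk measurable_const)
    simp only [← lintegral_const_mul _ (h7 _)]
    rw [← lintegral_finsetSum _ (fun i _ => (h7 i).const_mul _)]
    refine lintegral_congr fun xr => ?_
    simp only [pijD_succ, Fin.cons_zero, Finset.sum_mul, Finset.mul_sum]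
    rw [Finset.sum_comm]
    simp only [mul_assoc]

end Densities

section Doeblin

lemma fin_sum_lower {ι : Type*} (s : Finset ι) (p a A g : ι → ℝ≥0∞) (ρ δ lo M : ℝ≥0∞)
    (hρ : ρ + δ = 1) (hδ : δ * M ≤ lo)
    (hlo : ∀ j ∈ s, lo ≤ p j) (hM : ∀ j ∈ s, p j ≤ M)
    (haA : ∀ j ∈ s, a j ≤ A j) (hag : ∀ j ∈ s, a j ≤ g j) (hfin : ∀ j ∈ s, a j ≠ ∞)
    (hs : ∑ j ∈ s, g j = ∑ j ∈ s, A j) :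
    ∑ j ∈ s, p j * (ρ * a j + δ * g j) ≤ ∑ j ∈ s, p j * A j := by
  have hA : ∀ j ∈ s, A j = a j + (A j - a j) := fun j hj => (add_tsub_cancel_of_le (haA j hj)).symm
  have hg : ∀ j ∈ s, g j = a j + (g j - a j) := fun j hj => (add_tsub_cancel_of_le (hag j hj)).symm
  set h : ι → ℝ≥0∞ := fun j => A j - a j
  set k : ι → ℝ≥0∞ := fun j => g j - a j
  have hsum : ∑ j ∈ s, k j = ∑ j ∈ s, h j := by
    have h1 : ∑ j ∈ s, a j + ∑ j ∈ s, k j = ∑ j ∈ s, a j + ∑ j ∈ s, h j := by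
      rw [← Finset.sum_add_distrib, ← Finset.sum_add_distrib,
        ← Finset.sum_congr rfl hA, ← Finset.sum_congr rfl hg, hs]
    exact (ENNReal.add_right_inj (ENNReal.sum_ne_top.2 hfin)).1 h1
  calc ∑ j ∈ s, p j * (ρ * a j + δ * g j)
      = ∑ j ∈ s, p j * a j + δ * ∑ j ∈ s, p j * k j := by
        rw [Finset.mul_sum, ← Finset.sum_add_distrib]
        refine Finset.sum_congr rfl fun j hj => ?_
        rw [hg j hj]
        calc p j * (ρ * a j + δ * (a j + k j)) = (ρ + δ) * (p j * a j) + δ * (p j * k j) := by ring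
          _ = _ := by rw [hρ, one_mul]
    _ ≤ ∑ j ∈ s, p j * a j + δ * ∑ j ∈ s, M * k j := by
        gcongr with j hj; exact hM j hj
    _ = ∑ j ∈ s, p j * a j + δ * M * ∑ j ∈ s, h j := by
        rw [← Finset.mul_sum, hsum, mul_assoc]
    _ ≤ ∑ j ∈ s, p j * a j + lo * ∑ j ∈ s, h j := by gcongr
    _ ≤ ∑ j ∈ s, p j * a j + ∑ j ∈ s, p j * h j := by
        rw [Finset.mul_sum]
        gcongr with j hj; exact hlo j hj
    _ = ∑ j ∈ s, p j * A j := by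
        rw [← Finset.sum_add_distrib]
        refine Finset.sum_congr rfl fun j hj => ?_
        rw [← mul_add, ← hA j hj]

lemma fin_sum_upper {ι : Type*} (s : Finset ι) (p b A g : ι → ℝ≥0∞) (ρ δ lo M : ℝ≥0∞)
    (hρ : ρ + δ = 1) (hδ : δ * M ≤ lo) (hM' : M ≠ ∞)
    (hlo : ∀ j ∈ s, lo ≤ p j) (hM : ∀ j ∈ s, p j ≤ M)
    (haA : ∀ j ∈ s, A j ≤ b j) (hag : ∀ j ∈ s, g j ≤ b j) (hfin : ∀ j ∈ s, b j ≠ ∞)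
    (hs : ∑ j ∈ s, g j = ∑ j ∈ s, A j) :
    ∑ j ∈ s, p j * A j ≤ ∑ j ∈ s, p j * (ρ * b j + δ * g j) := by
  have hA : ∀ j ∈ s, b j = A j + (b j - A j) := fun j hj => (add_tsub_cancel_of_le (haA j hj)).symm
  have hg : ∀ j ∈ s, b j = g j + (b j - g j) := fun j hj => (add_tsub_cancel_of_le (hag j hj)).symm
  set h : ι → ℝ≥0∞ := fun j => b j - A j
  set k : ι → ℝ≥0∞ := fun j => b j - g j
  have hδ' : δ ≠ ∞ := by
    rintro rfl; simp at hρ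
  have hkfin : ∀ j ∈ s, k j ≠ ∞ := fun j hj => ne_top_of_le_ne_top (hfin j hj) tsub_le_self
  have hAfin : ∑ j ∈ s, A j ≠ ∞ :=
    ENNReal.sum_ne_top.2 fun j hj => ne_top_of_le_ne_top (hfin j hj) (haA j hj)
  have hsum : ∑ j ∈ s, k j = ∑ j ∈ s, h j := by
    have h1 : ∑ j ∈ s, A j + ∑ j ∈ s, k j = ∑ j ∈ s, A j + ∑ j ∈ s, h j := by
      rw [← hs, ← Finset.sum_add_distrib, ← Finset.sum_congr rfl hg, hs,
        ← Finset.sum_add_distrib, ← Finset.sum_congr rfl hA]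
    exact (ENNReal.add_right_inj hAfin).1 h1
  have hc : δ * ∑ j ∈ s, p j * k j ≠ ∞ := ENNReal.mul_ne_top hδ' (ENNReal.sum_ne_top.2 fun j hj =>
    ENNReal.mul_ne_top (ne_top_of_le_ne_top hM' (hM j hj)) (hkfin j hj))
  refine (ENNReal.add_le_add_iff_right hc).1 ?_
  calc ∑ j ∈ s, p j * A j + δ * ∑ j ∈ s, p j * k j
      ≤ ∑ j ∈ s, p j * A j + δ * ∑ j ∈ s, M * k j := by
        gcongr with j hj; exact hM j hj
    _ = ∑ j ∈ s, p j * A j + δ * M * ∑ j ∈ s, h j := by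
        rw [← Finset.mul_sum, hsum, mul_assoc]
    _ ≤ ∑ j ∈ s, p j * A j + lo * ∑ j ∈ s, h j := by gcongr
    _ ≤ ∑ j ∈ s, p j * A j + ∑ j ∈ s, p j * h j := by
        rw [Finset.mul_sum]
        gcongr with j hj; exact hlo j hj
    _ = ∑ j ∈ s, p j * b j := by
        rw [← Finset.sum_add_distrib]
        refine Finset.sum_congr rfl fun j hj => ?_
        rw [← mul_add, ← hA j hj]
    _ = ∑ j ∈ s, p j * (ρ * b j + δ * g j) + δ * ∑ j ∈ s, p j * k j := by
        rw [Finset.mul_sum, ← Finset.sum_add_distrib]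
        refine Finset.sum_congr rfl fun j hj => ?_
        calc p j * b j = (ρ + δ) * (p j * b j) := by rw [hρ, one_mul]
          _ = p j * ρ * b j + p j * δ * b j := by ring
          _ = p j * ρ * b j + p j * δ * (g j + k j) := by rw [← hg j hj]
          _ = _ := by ring

/-- Observation path of a path of the pair chain. -/
def XP (ω : ℕ → 𝓧 × 𝓨) : ℕ → 𝓧 := fun k => (ω k).1

/-- Tail of the signal path. -/
def YT (τ : ℕ) (ω : ℕ → 𝓧 × 𝓨) : ℕ → 𝓨 := fun k => (ω (τ + k)).2

lemma measurable_XP : Measurable (XP : (ℕ → 𝓧 × 𝓨) → ℕ → 𝓧) := by unfold XP; fun_prop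

lemma measurable_YT (τ : ℕ) : Measurable (YT τ : (ℕ → 𝓧 × 𝓨) → ℕ → 𝓨) := by unfold YT; fun_prop

/-- The functions `a ≤ b` bracket the conditional probability of `Y_{τ:∞} ∈ A`
given the observations, whatever the starting point. -/
def Good (Pz : 𝓧 × 𝓨 → Measure (ℕ → 𝓧 × 𝓨)) (A : Set (ℕ → 𝓨)) (τ : ℕ)
    (a b : (ℕ → 𝓧) → ℝ≥0∞) : Prop :=
  Measurable a ∧ Measurable b ∧ (∀ x, a x ≤ b x) ∧ (∀ x, b x ≤ 1) ∧
  ∀ (z : 𝓧 × 𝓨) (φ : (ℕ → 𝓧) → ℝ≥0∞), Measurable φ → (∀ x, φ x ≤ 1) →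
    ∫⁻ ω, φ (XP ω) * a (XP ω) ∂(Pz z) ≤
      ∫⁻ ω, φ (XP ω) * A.indicator (fun _ => 1) (YT τ ω) ∂(Pz z) ∧
    ∫⁻ ω, φ (XP ω) * A.indicator (fun _ => 1) (YT τ ω) ∂(Pz z) ≤
      ∫⁻ ω, φ (XP ω) * b (XP ω) ∂(Pz z)

lemma good_base (Pz : 𝓧 × 𝓨 → Measure (ℕ → 𝓧 × 𝓨)) (A : Set (ℕ → 𝓨)) (τ : ℕ) :
    Good Pz A τ (fun _ => 0) (fun _ => 1) := by
  refine ⟨measurable_const, measurable_const, fun _ => zero_le_one, fun _ => le_rfl, ?_⟩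
  intro z φ hφ _
  refine ⟨by simp, ?_⟩
  refine lintegral_mono fun ω => ?_
  gcongr
  exact Set.indicator_le_self' (fun _ _ => zero_le) _

/-- Prepending one observation. -/
def pcons (x0 : 𝓧) (x : ℕ → 𝓧) : ℕ → 𝓧 := fun k => Nat.casesOn k x0 x

lemma measurable_pcons : Measurable fun p : 𝓧 × (ℕ → 𝓧) => pcons p.1 p.2 := by
  refine measurable_pi_lambda _ fun k => ?_
  cases k with
  | zero => exact measurable_fst
  | succ k => exact (measurable_pi_apply k).comp measurable_snd

lemma good_shift [MeasurableSingletonClass 𝓧] {κ : Kernel (𝓧 × 𝓨) (𝓧 × 𝓨)}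
    {Pz : 𝓧 × 𝓨 → Measure (ℕ → 𝓧 × 𝓨)} (hF : IsMarkovFamily κ Pz) {A : Set (ℕ → 𝓨)}
    (hA : MeasurableSet A) {τ : ℕ} {a b : (ℕ → 𝓧) → ℝ≥0∞} (h : Good Pz A τ a b) :
    Good Pz A (1 + τ) (fun x => a (fun k => x (k + 1))) (fun x => b (fun k => x (k + 1))) := by
  obtain ⟨ha, hb, hab, hb1, H⟩ := h
  have hsh : Measurable fun (x : ℕ → 𝓧) k => x (k + 1) := by fun_prop
  refine ⟨ha.comp hsh, hb.comp hsh, fun x => hab _, fun x => hb1 _, ?_⟩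
  intro z φ hφ hφ1
  have key : ∀ f : (ℕ → 𝓧 × 𝓨) → ℝ≥0∞, Measurable f →
      ∫⁻ ω, φ (XP ω) * f (fun k => ω (k + 1)) ∂(Pz z) =
      ∫⁻ z', ∫⁻ ω', φ (pcons z.1 (XP ω')) * f ω' ∂(Pz z') ∂(κ z) := by
    intro f hf
    have h1 := one_step hF z (Φ := fun p => φ (pcons p.1.1 (XP p.2)) * f p.2) (by
      refine Measurable.mul (hφ.comp ?_) (hf.comp measurable_snd)
      exact measurable_pcons.comp ((measurable_fst.comp measurable_fst).prodMk
        (measurable_XP.comp measurable_snd)))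
    rw [← h1]
    refine lintegral_congr fun ω => ?_
    congr 2
    funext k
    cases k <;> rfl
  have hind : Measurable fun ω : ℕ → 𝓧 × 𝓨 => A.indicator (fun _ => (1 : ℝ≥0∞)) (YT τ ω) :=
    (measurable_const.indicator hA).comp (measurable_YT τ)
  have k1 := key (fun ω => a (XP ω)) (ha.comp measurable_XP)
  have k2 := key (fun ω => b (XP ω)) (hb.comp measurable_XP)
  have k3 := key _ hind
  have e3 : ∀ ω : ℕ → 𝓧 × 𝓨, YT τ (fun k => ω (k + 1)) = YT (1 + τ) ω := by
    intro ω; funext k; simp only [YT]; congr 2; omega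
  simp only [e3] at k3
  have hz' : ∀ z', _ := fun z' => H z' (fun x => φ (pcons z.1 x))
    (hφ.comp (measurable_pcons.comp (measurable_const.prodMk measurable_id))) (fun x => hφ1 _)
  constructor
  · rw [k3]
    refine (le_of_eq k1).trans ?_
    exact lintegral_mono fun z' => (hz' z').1
  · rw [k3]
    refine le_trans ?_ (le_of_eq k2.symm)
    exact lintegral_mono fun z' => (hz' z').2

lemma good_shifts [MeasurableSingletonClass 𝓧] {κ : Kernel (𝓧 × 𝓨) (𝓧 × 𝓨)}
    {Pz : 𝓧 × 𝓨 → Measure (ℕ → 𝓧 × 𝓨)} (hF : IsMarkovFamily κ Pz) {A : Set (ℕ → 𝓨)}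
    (hA : MeasurableSet A) {τ : ℕ} {a b : (ℕ → 𝓧) → ℝ≥0∞} (h : Good Pz A τ a b) (n : ℕ) :
    Good Pz A (n + τ) (fun x => a (fun k => x (n + k))) (fun x => b (fun k => x (n + k))) := by
  induction n with
  | zero => simpa using h
  | succ n ih =>
    have := good_shift hF hA ih
    convert this using 1
    · ring
    · funext x; congr 1; funext k; congr 1; ring
    · funext x; congr 1; funext k; congr 1; ring

/-- Sum of a kernel over finitely many hidden states. -/
noncomputable def sumK {W : Type*} [MeasurableSpace W] (K : Kernel (𝓧 × 𝓨) W) (Y2 : Finset 𝓨) :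
    Kernel 𝓧 W := ∑ j ∈ Y2, K.comap (fun x => (x, j)) (by fun_prop)

lemma sumK_apply {W : Type*} [MeasurableSpace W] (K : Kernel (𝓧 × 𝓨) W) (Y2 : Finset 𝓨) (x : 𝓧) :
    sumK K Y2 x = ∑ j ∈ Y2, K (x, j) := by
  simp [sumK]

lemma sumK_finite {W : Type*} [MeasurableSpace W] (K : Kernel (𝓧 × 𝓨) W) [IsFiniteKernel K]
    (Y2 : Finset 𝓨) : IsFiniteKernel (sumK K Y2) := by
  unfold sumK
  induction Y2 using Finset.induction_on with
  | empty => simp; infer_instance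
  | insert j s hj ih =>
    rw [Finset.sum_insert hj]
    infer_instance

end Doeblin

section Avg

lemma exists_avg [StandardBorelSpace 𝓧]
    {κ : Kernel (𝓧 × 𝓨) (𝓧 × 𝓨)}
    {Pz : 𝓧 × 𝓨 → Measure (ℕ → 𝓧 × 𝓨)} (hF : IsMarkovFamily κ Pz) {A : Set (ℕ → 𝓨)}
    (hA : MeasurableSet A) {τ : ℕ} {a b : (ℕ → 𝓧) → ℝ≥0∞} (h : Good Pz A τ a b)
    (Y2 : Finset 𝓨) :
    ∃ g : (ℕ → 𝓧) → ℝ≥0∞, Measurable g ∧ (∀ x, a x ≤ g x) ∧ (∀ x, g x ≤ b x) ∧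
      ∀ (x : 𝓧) (φ : (ℕ → 𝓧) → ℝ≥0∞), Measurable φ →
        ∑ j ∈ Y2, ∫⁻ ω, φ (XP ω) * g (XP ω) ∂(Pz (x, j)) =
        ∑ j ∈ Y2, ∫⁻ ω, φ (XP ω) * A.indicator (fun _ => 1) (YT τ ω) ∂(Pz (x, j)) := by
  obtain ⟨ha, hb, hab, hb1, H⟩ := h
  have hAτ : MeasurableSet ((YT τ : (ℕ → 𝓧 × 𝓨) → ℕ → 𝓨) ⁻¹' A) := measurable_YT τ hA
  set KB : Kernel (𝓧 × 𝓨) (ℕ → 𝓧) := (pathK hF).map XP with hKB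
  set KG : Kernel (𝓧 × 𝓨) (ℕ → 𝓧) := ((pathK hF).restrict hAτ).map XP with hKG
  have hfB : IsFiniteKernel (sumK KB Y2) := sumK_finite _ _
  have hfG : IsFiniteKernel (sumK KG Y2) := sumK_finite _ _
  set B := sumK KB Y2 with hBdef
  set G := sumK KG Y2 with hGdef
  have intB : ∀ (x : 𝓧) (f : (ℕ → 𝓧) → ℝ≥0∞), Measurable f →
      ∫⁻ w, f w ∂(B x) = ∑ j ∈ Y2, ∫⁻ ω, f (XP ω) ∂(Pz (x, j)) := by
    intro x f hf
    rw [hBdef, sumK_apply, lintegral_finsetSum_measure]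
    refine Finset.sum_congr rfl fun j _ => ?_
    rw [hKB, Kernel.map_apply _ measurable_XP, lintegral_map hf measurable_XP, pathK_apply]
  have intG : ∀ (x : 𝓧) (f : (ℕ → 𝓧) → ℝ≥0∞), Measurable f →
      ∫⁻ w, f w ∂(G x) = ∑ j ∈ Y2,
        ∫⁻ ω, f (XP ω) * A.indicator (fun _ => 1) (YT τ ω) ∂(Pz (x, j)) := by
    intro x f hf
    rw [hGdef, sumK_apply, lintegral_finsetSum_measure]
    refine Finset.sum_congr rfl fun j _ => ?_
    rw [hKG, Kernel.map_apply _ measurable_XP, lintegral_map hf measurable_XP,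
      Kernel.restrict_apply, pathK_apply, ← lintegral_indicator hAτ]
    refine lintegral_congr fun ω => ?_
    by_cases hω : YT τ ω ∈ A
    · rw [Set.indicator_of_mem hω, Set.indicator_of_mem (by exact hω), mul_one]
    · rw [Set.indicator_of_notMem hω, Set.indicator_of_notMem (by exact hω), mul_zero]
  have hAC : ∀ x, G x ≪ B x := by
    intro x
    refine Measure.absolutelyContinuous_of_le ?_
    refine Measure.le_intro fun s hs _ => ?_
    rw [← lintegral_indicator_one hs, ← lintegral_indicator_one hs,
      intB x _ (measurable_one.indicator hs), intG x _ (measurable_one.indicator hs)]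
    refine Finset.sum_le_sum fun j _ => lintegral_mono fun ω => ?_
    exact mul_le_of_le_one_right zero_le (Set.indicator_le_self' (fun _ _ => zero_le) _)
  set D : 𝓧 → (ℕ → 𝓧) → ℝ≥0∞ := Kernel.rnDeriv G B with hD
  have hDm : Measurable fun p : 𝓧 × (ℕ → 𝓧) => D p.1 p.2 := Kernel.measurable_rnDeriv G B
  have hDx : ∀ x, Measurable (D x) := fun x => Kernel.measurable_rnDeriv_right G B x
  have hwd : ∀ x, (B x).withDensity (D x) = G x := by
    intro x
    have := Kernel.withDensity_rnDeriv_eq (hAC x)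
    rwa [Kernel.withDensity_apply _ (Kernel.measurable_rnDeriv G B)] at this
  have intD : ∀ (x : 𝓧) (f : (ℕ → 𝓧) → ℝ≥0∞), Measurable f →
      ∫⁻ w, f w * D x w ∂(B x) = ∫⁻ w, f w ∂(G x) := by
    intro x f hf
    rw [← hwd x, lintegral_withDensity_eq_lintegral_mul _ (hDx x) hf]
    refine lintegral_congr fun w => ?_
    simp [mul_comm]
  have hφs : ∀ s : Set (ℕ → 𝓧), MeasurableSet s →
      Measurable (s.indicator (fun _ => (1 : ℝ≥0∞))) := fun s hs => measurable_const.indicator hs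
  have setint : ∀ (m : Measure (ℕ → 𝓧)) (f : (ℕ → 𝓧) → ℝ≥0∞) (s : Set (ℕ → 𝓧)), MeasurableSet s →
      ∫⁻ w in s, f w ∂m = ∫⁻ w, s.indicator (fun _ => 1) w * f w ∂m := by
    intro m f s hs
    rw [← lintegral_indicator hs]
    refine lintegral_congr fun w => ?_
    by_cases hw : w ∈ s <;> simp [hw]
  have hlow : ∀ x, a ≤ᵐ[B x] D x := by
    intro x
    refine ae_le_of_forall_setLIntegral_le_of_sigmaFinite ha fun s hs _ => ?_
    rw [setint _ _ s hs, setint _ _ s hs, intD x _ (hφs s hs), intG x _ (hφs s hs),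
      intB x _ ((hφs s hs).fun_mul ha)]
    exact Finset.sum_le_sum fun j _ => (H (x, j) _ (hφs s hs)
      (fun x => Set.indicator_le_self' (fun _ _ => zero_le) _)).1
  have hupp : ∀ x, D x ≤ᵐ[B x] b := by
    intro x
    refine ae_le_of_forall_setLIntegral_le_of_sigmaFinite (hDx x) fun s hs _ => ?_
    rw [setint _ _ s hs, setint _ _ s hs, intD x _ (hφs s hs), intG x _ (hφs s hs),
      intB x _ ((hφs s hs).fun_mul hb)]
    exact Finset.sum_le_sum fun j _ => (H (x, j) _ (hφs s hs)
      (fun x => Set.indicator_le_self' (fun _ _ => zero_le) _)).2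
  refine ⟨fun w => max (a w) (min (D (w 0) w) (b w)), ?_, fun w => le_max_left _ _,
    fun w => max_le (hab w) (min_le_right _ _), ?_⟩
  · refine ha.max (Measurable.min ?_ hb)
    have h0 : Measurable fun w : ℕ → 𝓧 => ((w 0, w) : 𝓧 × (ℕ → 𝓧)) := by fun_prop
    exact hDm.comp h0
  · intro x φ hφ
    rw [← intG x φ hφ, ← intD x φ hφ, intB x _ (hφ.fun_mul (hDx x))]
    refine Finset.sum_congr rfl fun j hj => lintegral_congr_ae ?_
    have hac : ∀ p : (ℕ → 𝓧) → Prop, (∀ᵐ w ∂(B x), p w) → ∀ᵐ ω ∂(Pz (x, j)), p (XP ω) := by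
      intro p hp
      have hle : (Pz (x, j)).map XP ≤ B x := by
        rw [hBdef, sumK_apply]
        have : (Pz (x, j)).map XP = KB (x, j) := by
          rw [hKB, Kernel.map_apply _ measurable_XP, pathK_apply]
        rw [this]
        exact Finset.single_le_sum (f := fun j => KB (x, j)) (fun _ _ => Measure.zero_le _) hj
      exact ae_of_ae_map measurable_XP.aemeasurable (ae_mono hle hp)
    filter_upwards [hac _ (hlow x), hac _ (hupp x), fam_zero hF (x, j)] with ω h1 h2 h3
    have h4 : XP ω 0 = x := by simp [XP, h3]
    simp only [h4]
    rw [min_eq_left h2, max_eq_right h1]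

end Avg

section Block

/-- First `R + 1` entries of a path. -/
def blk (R : ℕ) (w : ℕ → 𝓧) : Fin (R + 1) → 𝓧 := fun k => w k

lemma measurable_blk (R : ℕ) : Measurable (blk R : (ℕ → 𝓧) → _) := by unfold blk; fun_prop

/-- Glueing of a block and a path. -/
def glue {R : ℕ} (x : Fin (R + 1) → 𝓧) (w : ℕ → 𝓧) : ℕ → 𝓧 :=
  fun k => if h : k < R + 1 then x ⟨k, h⟩ else w (k - R)

lemma measurable_glue {R : ℕ} : Measurable fun p : (Fin (R + 1) → 𝓧) × (ℕ → 𝓧) => glue p.1 p.2 := by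
  refine measurable_pi_lambda _ fun k => ?_
  unfold glue
  by_cases h : k < R + 1
  · simp only [h, dif_pos]; fun_prop
  · simp only [h, dif_neg, not_false_eq_true]; fun_prop

lemma glue_blk (R : ℕ) (w : ℕ → 𝓧) : glue (blk R w) (fun k => w (R + k)) = w := by
  funext k
  unfold glue blk
  by_cases h : k < R + 1
  · simp [h]
  · simp only [h]
    change w (R + (k - R)) = w k
    congr 1; omega

lemma measurable_fcons {R : ℕ} : Measurable fun p : 𝓧 × (Fin R → 𝓧) =>
    (Fin.cons p.1 p.2 : Fin (R + 1) → 𝓧) := by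
  refine measurable_pi_lambda _ fun k => ?_
  refine Fin.cases ?_ (fun k => ?_) k
  · simpa using measurable_fst
  · simp only [Fin.cons_succ]; fun_prop

lemma block_formula [MeasurableSingletonClass 𝓧] {κ : Kernel (𝓧 × 𝓨) (𝓧 × 𝓨)} {μ : Measure 𝓧} [SigmaFinite μ]
    {q : 𝓧 × 𝓨 → 𝓧 × 𝓨 → ℝ≥0∞} (hq : Measurable (Function.uncurry q))
    (hκ : ∀ z : 𝓧 × 𝓨, (κ z : Measure (𝓧 × 𝓨)) =
      (μ.prod Measure.count).withDensity (fun z' => q z' z))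
    {Pz : 𝓧 × 𝓨 → Measure (ℕ → 𝓧 × 𝓨)} (hF : IsMarkovFamily κ Pz) (R : ℕ)
    {F : (Fin (R + 1) → 𝓧) × (ℕ → 𝓧 × 𝓨) → ℝ≥0∞} (hFm : Measurable F) (z : 𝓧 × 𝓨) :
    ∫⁻ ω, F (blk R (XP ω), fun k => ω (R + k)) ∂(Pz z) =
      ∫⁻ xr, ∑ j : 𝓨, pijD q (Fin.cons z.1 xr : Fin (R + 1) → 𝓧) z.2 j *
        ∫⁻ ω', F (Fin.cons z.1 xr, ω') ∂(Pz ((Fin.cons z.1 xr : Fin (R + 1) → 𝓧) (Fin.last R), j))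
          ∂(Measure.pi fun _ : Fin R => μ) := by
  have := hF.1 z
  have h1 := markov_joint hF (famChain hF z) R (Φ := fun p => F (blk R (XP p.1), p.2)) (by
    refine hFm.comp (Measurable.prodMk ?_ measurable_snd)
    exact (measurable_blk R).comp (measurable_XP.comp measurable_fst))
  have e : ∀ ω : ℕ → 𝓧 × 𝓨, blk R (XP fun i => ω (min i R)) = fun k : Fin (R + 1) => (ω k).1 := by
    intro ω
    funext k
    simp only [blk, XP]
    rw [Nat.min_eq_left (by omega)]
  simp only [e] at h1
  refine h1.trans ?_
  have h2 := dens hq hκ hF R (fun p => ∫⁻ ω', F (p.1, ω') ∂(Pz (p.1 (Fin.last R), p.2))) (by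
    have hm : Measurable fun p : (Fin (R + 1) → 𝓧) × 𝓨 => (p.1 (Fin.last R), p.2) := by fun_prop
    refine Measurable.lintegral_kernel_prod_right (κ := (pathK hF).comap _ hm)
      (f := fun p ω' => F (p.1, ω')) ?_
    exact hFm.comp (by fun_prop)) z
  refine Eq.trans ?_ h2
  refine lintegral_congr fun ω => ?_
  simp

lemma block_step [StandardBorelSpace 𝓧] {κ : Kernel (𝓧 × 𝓨) (𝓧 × 𝓨)} {μ : Measure 𝓧} [SigmaFinite μ]
    {q : 𝓧 × 𝓨 → 𝓧 × 𝓨 → ℝ≥0∞} (hq : Measurable (Function.uncurry q))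
    (hκ : ∀ z : 𝓧 × 𝓨, (κ z : Measure (𝓧 × 𝓨)) =
      (μ.prod Measure.count).withDensity (fun z' => q z' z))
    {Pz : 𝓧 × 𝓨 → Measure (ℕ → 𝓧 × 𝓨)} (hF : IsMarkovFamily κ Pz) {R : ℕ}
    {E : Set (Fin (R + 1) → 𝓧)} (hE : MeasurableSet E) (Y2 : Finset 𝓨) {lo M ρ δ : ℝ≥0∞}
    (hEp : ∀ x ∈ E, ∀ i, (∀ j, pijD q x i j = 0) ∨
      ((∀ j ∈ Y2, lo ≤ pijD q x i j ∧ pijD q x i j ≤ M) ∧ ∀ j ∉ Y2, pijD q x i j = 0))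
    (hρ : ρ + δ = 1) (hδ : δ * M ≤ lo) (hM : M ≠ ∞)
    {A : Set (ℕ → 𝓨)} (hA : MeasurableSet A) {τ : ℕ} {a b : (ℕ → 𝓧) → ℝ≥0∞}
    (h : Good Pz A τ a b) :
    ∃ a' b' : (ℕ → 𝓧) → ℝ≥0∞, Good Pz A (R + τ) a' b' ∧
      ∀ (w : ℕ → 𝓧) (ε : ℝ≥0∞), b (fun k => w (R + k)) ≤ a (fun k => w (R + k)) + ε →
        (blk R w ∈ E → b' w ≤ a' w + ρ * ε) ∧ (blk R w ∉ E → b' w ≤ a' w + ε) := by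
  classical
  obtain ⟨g, hg, hag, hgb, hsum⟩ := exists_avg hF hA h Y2
  obtain ⟨ha, hb, hab, hb1, H⟩ := h
  have hEb : MeasurableSet {w : ℕ → 𝓧 | blk R w ∈ E} := measurable_blk R hE
  have hsh : Measurable fun (x : ℕ → 𝓧) k => x (R + k) := by fun_prop
  -- the mixing operation
  set mix : ((ℕ → 𝓧) → ℝ≥0∞) → (Fin (R + 1) → 𝓧) → (ℕ → 𝓧) → ℝ≥0∞ :=
    fun f x w => if x ∈ E then ρ * f w + δ * g w else f w with hmix
  have hmixm : ∀ f : (ℕ → 𝓧) → ℝ≥0∞, Measurable f →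
      Measurable fun p : (Fin (R + 1) → 𝓧) × (ℕ → 𝓧) => mix f p.1 p.2 := by
    intro f hf
    refine Measurable.ite (measurable_fst hE) ?_ (hf.comp measurable_snd)
    exact ((hf.comp measurable_snd).const_mul _).add ((hg.comp measurable_snd).const_mul _)
  have hmixm' : ∀ f : (ℕ → 𝓧) → ℝ≥0∞, Measurable f →
      Measurable fun w : ℕ → 𝓧 => mix f (blk R w) (fun k => w (R + k)) := fun f hf =>
    (hmixm f hf).comp ((measurable_blk R).prodMk hsh)
  have formula : ∀ (φ : (ℕ → 𝓧) → ℝ≥0∞), Measurable φ →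
      ∀ (f : (Fin (R + 1) → 𝓧) × (ℕ → 𝓧 × 𝓨) → ℝ≥0∞), Measurable f → ∀ z : 𝓧 × 𝓨,
      ∫⁻ ω, φ (XP ω) * f (blk R (XP ω), fun k => ω (R + k)) ∂(Pz z) =
      ∫⁻ xr, ∑ j : 𝓨, pijD q (Fin.cons z.1 xr : Fin (R + 1) → 𝓧) z.2 j *
        ∫⁻ ω', φ (glue (Fin.cons z.1 xr : Fin (R + 1) → 𝓧) (XP ω')) * f (Fin.cons z.1 xr, ω')
          ∂(Pz ((Fin.cons z.1 xr : Fin (R + 1) → 𝓧) (Fin.last R), j))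
          ∂(Measure.pi fun _ : Fin R => μ) := by
    intro φ hφ f hf z
    have h1 := block_formula hq hκ hF R (F := fun p => φ (glue p.1 (XP p.2)) * f p) (by
      refine Measurable.mul (hφ.comp ?_) hf
      exact measurable_glue.comp (measurable_fst.prodMk (measurable_XP.comp measurable_snd))) z
    rw [← h1]
    refine lintegral_congr fun ω => ?_
    have : glue (blk R (XP ω)) (XP fun k => ω (R + k)) = XP ω := glue_blk R (XP ω)
    rw [this]
  have hind : Measurable fun ω : ℕ → 𝓧 × 𝓨 => A.indicator (fun _ => (1 : ℝ≥0∞)) (YT τ ω) :=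
    (measurable_const.indicator hA).comp (measurable_YT τ)
  have e3 : ∀ ω : ℕ → 𝓧 × 𝓨, YT τ (fun k => ω (R + k)) = YT (R + τ) ω := by
    intro ω; funext k; simp only [YT]; congr 2; omega
  have hδ1 : δ ≤ 1 := hρ ▸ le_add_self
  have hφg : ∀ {x : Fin (R + 1) → 𝓧} {φ : (ℕ → 𝓧) → ℝ≥0∞}, Measurable φ →
      Measurable fun w => φ (glue x w) := fun hφ =>
    hφ.comp (measurable_glue.comp (measurable_const.prodMk measurable_id))
  have fin : ∀ (φ f : (ℕ → 𝓧) → ℝ≥0∞), (∀ x, φ x ≤ 1) → (∀ x, f x ≤ 1) → ∀ z : 𝓧 × 𝓨,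
      ∫⁻ ω, φ (XP ω) * f (XP ω) ∂(Pz z) ≠ ∞ := by
    intro φ f h1 h2 z
    have := hF.1 z
    refine ne_top_of_le_ne_top (ENNReal.one_ne_top) ?_
    calc ∫⁻ ω, φ (XP ω) * f (XP ω) ∂(Pz z) ≤ ∫⁻ _, 1 ∂(Pz z) :=
          lintegral_mono fun ω => mul_le_one' (h1 _) (h2 _)
      _ = 1 := by simp
  -- splitting of the mixed integral
  have split : ∀ (φ f : (ℕ → 𝓧) → ℝ≥0∞), Measurable φ → Measurable f → ∀ z : 𝓧 × 𝓨,
      ∫⁻ ω, φ (XP ω) * (ρ * f (XP ω) + δ * g (XP ω)) ∂(Pz z) =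
      ρ * ∫⁻ ω, φ (XP ω) * f (XP ω) ∂(Pz z) + δ * ∫⁻ ω, φ (XP ω) * g (XP ω) ∂(Pz z) := by
    intro φ f hφ hf z
    have m1 : Measurable fun ω : ℕ → 𝓧 × 𝓨 => φ (XP ω) * f (XP ω) :=
      (hφ.comp measurable_XP).mul (hf.comp measurable_XP)
    have m2 : Measurable fun ω : ℕ → 𝓧 × 𝓨 => φ (XP ω) * g (XP ω) :=
      (hφ.comp measurable_XP).mul (hg.comp measurable_XP)
    rw [← lintegral_const_mul _ m1, ← lintegral_const_mul _ m2,
      ← lintegral_add_left (m1.const_mul _)]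
    refine lintegral_congr fun ω => ?_
    ring
  -- restriction of the sums to `Y2`
  have restr : ∀ (p v : 𝓨 → ℝ≥0∞), (∀ j ∉ Y2, p j = 0) → ∑ j, p j * v j = ∑ j ∈ Y2, p j * v j := by
    intro p v hp
    refine (Finset.sum_subset (Finset.subset_univ _) fun j _ hj => ?_).symm
    rw [hp j hj, zero_mul]
  refine ⟨fun w => mix a (blk R w) (fun k => w (R + k)), fun w => mix b (blk R w) (fun k => w (R + k)),
    ⟨hmixm' a ha, hmixm' b hb, ?_, ?_, ?_⟩, ?_⟩
  · intro w
    simp only [hmix]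
    split_ifs
    · gcongr; exact hab _
    · exact hab _
  · intro w
    simp only [hmix]
    split_ifs
    · calc _ ≤ ρ * 1 + δ * 1 := by
            gcongr
            · exact hb1 _
            · exact (hgb _).trans (hb1 _)
        _ = 1 := by simpa using hρ
    · exact hb1 _
  · intro z φ hφ hφ1
    have k1 := formula φ hφ (fun p => mix a p.1 (XP p.2))
      ((hmixm a ha).comp (measurable_fst.prodMk (measurable_XP.comp measurable_snd))) z
    have k2 := formula φ hφ (fun p => mix b p.1 (XP p.2))
      ((hmixm b hb).comp (measurable_fst.prodMk (measurable_XP.comp measurable_snd))) z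
    have k3 := formula φ hφ (fun p => A.indicator (fun _ => 1) (YT τ p.2))
      (hind.comp measurable_snd) z
    simp only [e3] at k3
    rw [k3]
    constructor
    · refine (le_of_eq k1).trans ?_
      refine lintegral_mono fun xr => ?_
      set x : Fin (R + 1) → 𝓧 := Fin.cons z.1 xr
      simp only [hmix]
      by_cases hx : x ∈ E
      · simp only [hx, if_true]
        rcases hEp x hx z.2 with h0 | ⟨h1, h2⟩
        · simp [h0]
        rw [restr _ _ h2, restr _ _ h2]
        simp only [split (fun w => φ (glue x w)) a (hφg hφ) ha]
        refine fin_sum_lower Y2 _ (fun j => ∫⁻ ω', φ (glue x (XP ω')) * a (XP ω') ∂(Pz (x (Fin.last R), j)))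
          _ _ ρ δ lo M hρ hδ (fun j hj => (h1 j hj).1) (fun j hj => (h1 j hj).2) ?_ ?_ ?_ ?_
        · exact fun j _ => (H _ (fun w => φ (glue x w)) (hφg hφ) (fun _ => hφ1 _)).1
        · exact fun j _ => lintegral_mono fun ω => by gcongr; exact hag _
        · exact fun j _ => fin (fun w => φ (glue x w)) a (fun _ => hφ1 _)
            (fun w => (hab w).trans (hb1 w)) _
        · exact hsum _ (fun w => φ (glue x w)) (hφg hφ)
      · simp only [hx, if_false]
        refine Finset.sum_le_sum fun j _ => mul_le_mul_right ?_ _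
        exact (H _ (fun w => φ (glue x w)) (hφg hφ) (fun _ => hφ1 _)).1
    · refine le_trans ?_ (le_of_eq k2.symm)
      refine lintegral_mono fun xr => ?_
      set x : Fin (R + 1) → 𝓧 := Fin.cons z.1 xr
      simp only [hmix]
      by_cases hx : x ∈ E
      · simp only [hx, if_true]
        rcases hEp x hx z.2 with h0 | ⟨h1, h2⟩
        · simp [h0]
        rw [restr _ _ h2, restr _ _ h2]
        simp only [split (fun w => φ (glue x w)) b (hφg hφ) hb]
        refine fin_sum_upper Y2 _ (fun j => ∫⁻ ω', φ (glue x (XP ω')) * b (XP ω') ∂(Pz (x (Fin.last R), j)))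
          _ _ ρ δ lo M hρ hδ hM (fun j hj => (h1 j hj).1) (fun j hj => (h1 j hj).2) ?_ ?_ ?_ ?_
        · exact fun j _ => (H _ (fun w => φ (glue x w)) (hφg hφ) (fun _ => hφ1 _)).2
        · exact fun j _ => lintegral_mono fun ω => by gcongr; exact hgb _
        · exact fun j _ => fin (fun w => φ (glue x w)) b (fun _ => hφ1 _) hb1 _
        · exact hsum _ (fun w => φ (glue x w)) (hφg hφ)
      · simp only [hx, if_false]
        refine Finset.sum_le_sum fun j _ => mul_le_mul_right ?_ _
        exact (H _ (fun w => φ (glue x w)) (hφg hφ) (fun _ => hφ1 _)).2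
  · intro w ε hε
    refine ⟨fun hw => ?_, fun hw => ?_⟩
    · simp only [hmix, hw, if_true]
      calc _ ≤ ρ * (a (fun k => w (R + k)) + ε) + δ * g (fun k => w (R + k)) := by gcongr
        _ = _ := by ring
    · simp only [hmix, hw, if_false]
      exact hε

/-- Number of `E`-blocks among the first `u` consecutive blocks. -/
noncomputable def nblk {R : ℕ} (E : Set (Fin (R + 1) → 𝓧)) (u : ℕ) (w : ℕ → 𝓧) : ℕ :=
  ∑ v ∈ Finset.range u, E.indicator (fun _ => 1) (blk R fun k => w (v * R + k))

lemma nblk_succ {R : ℕ} (E : Set (Fin (R + 1) → 𝓧)) (u : ℕ) (w : ℕ → 𝓧) :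
    nblk E (u + 1) w = nblk E u (fun k => w (R + k)) + E.indicator (fun _ => 1) (blk R w) := by
  unfold nblk
  rw [Finset.sum_range_succ']
  congr 1
  · refine Finset.sum_congr rfl fun v _ => ?_
    congr 2; funext k; congr 1; ring
  · simp

lemma block_iter [StandardBorelSpace 𝓧] {κ : Kernel (𝓧 × 𝓨) (𝓧 × 𝓨)} {μ : Measure 𝓧} [SigmaFinite μ]
    {q : 𝓧 × 𝓨 → 𝓧 × 𝓨 → ℝ≥0∞} (hq : Measurable (Function.uncurry q))
    (hκ : ∀ z : 𝓧 × 𝓨, (κ z : Measure (𝓧 × 𝓨)) =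
      (μ.prod Measure.count).withDensity (fun z' => q z' z))
    {Pz : 𝓧 × 𝓨 → Measure (ℕ → 𝓧 × 𝓨)} (hF : IsMarkovFamily κ Pz) {R : ℕ}
    {E : Set (Fin (R + 1) → 𝓧)} (hE : MeasurableSet E) (Y2 : Finset 𝓨) {lo M ρ δ : ℝ≥0∞}
    (hEp : ∀ x ∈ E, ∀ i, (∀ j, pijD q x i j = 0) ∨
      ((∀ j ∈ Y2, lo ≤ pijD q x i j ∧ pijD q x i j ≤ M) ∧ ∀ j ∉ Y2, pijD q x i j = 0))
    (hρ : ρ + δ = 1) (hδ : δ * M ≤ lo) (hM : M ≠ ∞)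
    {A : Set (ℕ → 𝓨)} (hA : MeasurableSet A) (r u τ : ℕ) :
    ∃ a b : (ℕ → 𝓧) → ℝ≥0∞, Good Pz A (r + (u * R + τ)) a b ∧
      ∀ w : ℕ → 𝓧, b w ≤ a w + ρ ^ nblk E u (fun k => w (r + k)) := by
  suffices h : ∃ a b : (ℕ → 𝓧) → ℝ≥0∞, Good Pz A (u * R + τ) a b ∧
      ∀ w : ℕ → 𝓧, b w ≤ a w + ρ ^ nblk E u w by
    obtain ⟨a, b, h1, h2⟩ := h
    exact ⟨_, _, good_shifts hF hA h1 r, fun w => h2 _⟩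
  induction u with
  | zero => exact ⟨_, _, good_base Pz A _, fun w => by simp [nblk]⟩
  | succ u ih =>
    obtain ⟨a, b, h1, h2⟩ := ih
    obtain ⟨a', b', h3, h4⟩ := block_step hq hκ hF hE Y2 hEp hρ hδ hM hA h1
    refine ⟨a', b', ?_, fun w => ?_⟩
    · convert h3 using 1; ring
    · have h5 := h4 w _ (h2 _)
      rw [nblk_succ]
      by_cases hw : blk R w ∈ E
      · have := h5.1 hw
        rwa [Set.indicator_of_mem hw, pow_succ, mul_comm (ρ ^ _)]
      · have := h5.2 hw
        rwa [Set.indicator_of_notMem hw, add_zero]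

end Block

section ChooseE

lemma choose_E [StandardBorelSpace 𝓧] {κ : Kernel (𝓧 × 𝓨) (𝓧 × 𝓨)} {μ : Measure 𝓧} [SigmaFinite μ]
    {q : 𝓧 × 𝓨 → 𝓧 × 𝓨 → ℝ≥0∞} (hq : Measurable (Function.uncurry q))
    (hκ : ∀ z : 𝓧 × 𝓨, (κ z : Measure (𝓧 × 𝓨)) =
      (μ.prod Measure.count).withDensity (fun z' => q z' z))
    {Pz : 𝓧 × 𝓨 → Measure (ℕ → 𝓧 × 𝓨)} (hF : IsMarkovFamily κ Pz) {ψ : Measure (𝓧 × 𝓨)} {R : ℕ}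
    {E : Set (Fin (R + 1) → 𝓧)} {Yp : Set (𝓨 × 𝓨)}
    (hA1 : Assumption1 q E Yp) (hA2 : Assumption2 κ ψ μ E Yp) :
    ∃ (E' : Set (Fin (R + 1) → 𝓧)) (Y2 : Finset 𝓨) (lo M ρ δ : ℝ≥0∞), MeasurableSet E' ∧
      (∀ x ∈ E', ∀ i, (∀ j, pijD q x i j = 0) ∨
        ((∀ j ∈ Y2, lo ≤ pijD q x i j ∧ pijD q x i j ≤ M) ∧ ∀ j ∉ Y2, pijD q x i j = 0)) ∧
      ρ + δ = 1 ∧ δ * M ≤ lo ∧ M ≠ ∞ ∧ 0 < ρ ∧ ρ < 1 ∧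
      ∃ B : Set (𝓧 × 𝓨), MeasurableSet B ∧ 0 < ψ B ∧
        ∀ z ∈ B, 0 < Pz z {ω | blk R (XP ω) ∈ E'} := by
  classical
  obtain ⟨-, -, hEY, hprod⟩ := hA1
  obtain ⟨-, hψ, hsec⟩ := hA2
  set lo : ℕ → ℝ≥0∞ := fun n => ((n : ℝ≥0∞) + 2)⁻¹ with hlo
  have hlo0 : ∀ n, 0 < lo n := fun n => ENNReal.inv_pos.2 (by finiteness)
  set En : ℕ → Set (Fin (R + 1) → 𝓧) := fun n => {x | ∀ p : 𝓨 × 𝓨,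
    (p ∈ Yp → lo n ≤ pijD q x p.1 p.2 ∧ pijD q x p.1 p.2 ≤ n + 2) ∧
    (p ∉ Yp → pijD q x p.1 p.2 = 0)} with hEn
  have hEnm : ∀ n, MeasurableSet (En n) := by
    intro n
    simp only [hEn, Set.ofPred_forall]
    refine MeasurableSet.iInter fun p => ?_
    have hp := measurable_pijD (R := R) hq p.1 p.2
    by_cases h : p ∈ Yp
    · simp only [h, forall_const, not_true_eq_false, false_imp_iff, and_true]
      exact (measurableSet_le measurable_const hp).inter (measurableSet_le hp measurable_const)
    · simp only [h, forall_const, false_imp_iff, true_and, not_false_eq_true]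
      exact hp (measurableSet_singleton 0)
  set An : ℕ → Set 𝓧 := fun n =>
    {x | 0 < (Measure.pi fun _ : Fin R => μ) (secSet (En n) x)} with hAn
  have hAnm : ∀ n, MeasurableSet (An n) := by
    intro n
    have := measurable_measure_prodMk_left (ν := Measure.pi fun _ : Fin R => μ)
      (measurable_fcons (hEnm n))
    exact measurableSet_lt measurable_const this
  -- finiteness
  have hfin : ∀ x₁ : 𝓧, ∀ᵐ xr ∂(Measure.pi fun _ : Fin R => μ), ∀ p : 𝓨 × 𝓨,
      pijD q (Fin.cons x₁ xr : Fin (R + 1) → 𝓧) p.1 p.2 < ∞ := by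
    intro x₁
    have hi : ∀ i : 𝓨, ∀ᵐ xr ∂(Measure.pi fun _ : Fin R => μ),
        ∑ j, pijD q (Fin.cons x₁ xr : Fin (R + 1) → 𝓧) i j < ∞ := by
      intro i
      have h1 := dens hq hκ hF R (fun _ => 1) measurable_const (x₁, i)
      have := hF.1 (x₁, i)
      simp only [mul_one, lintegral_const, measure_univ] at h1
      refine ae_lt_top ?_ (by rw [← h1]; simp)
      refine Finset.measurable_fun_sum _ fun j _ => ?_
      exact (measurable_pijD hq _ _).comp (measurable_fcons.comp (measurable_const.prodMk measurable_id))
    filter_upwards [ae_all_iff.2 hi] with xr h p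
    exact lt_of_le_of_lt (Finset.single_le_sum
      (f := fun j => pijD q (Fin.cons x₁ xr : Fin (R + 1) → 𝓧) p.1 j) (fun _ _ => zero_le)
      (Finset.mem_univ p.2)) (h p.1)
  have hcover : ∀ x ∈ E, (∀ p : 𝓨 × 𝓨, pijD q x p.1 p.2 < ∞) → ∃ n, x ∈ En n := by
    intro x hx hx'
    have hp : ∀ p : 𝓨 × 𝓨, ∃ N : ℕ, ∀ n ≥ N,
        (p ∈ Yp → lo n ≤ pijD q x p.1 p.2 ∧ pijD q x p.1 p.2 ≤ n + 2) ∧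
        (p ∉ Yp → pijD q x p.1 p.2 = 0) := by
      intro p
      have hiff : p ∈ Yp ↔ 0 < pijD q x p.1 p.2 := by rw [← hEY x hx]; rfl
      by_cases h : p ∈ Yp
      · have h0 := hiff.1 h
        obtain ⟨n1, hn1⟩ := ENNReal.exists_nat_gt (hx' p).ne
        obtain ⟨n2, hn2⟩ := ENNReal.exists_inv_nat_lt h0.ne'
        refine ⟨max n1 n2, fun n hn => ⟨fun _ => ⟨?_, ?_⟩, fun h' => absurd h h'⟩⟩
        · refine le_trans ?_ hn2.le
          refine ENNReal.inv_le_inv.2 ?_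
          have : (n2 : ℝ≥0∞) ≤ n := by exact_mod_cast (le_max_right _ _).trans hn
          exact this.trans le_self_add
        · have : (n1 : ℝ≥0∞) ≤ n := by exact_mod_cast (le_max_left _ _).trans hn
          exact hn1.le.trans (this.trans le_self_add)
      · refine ⟨0, fun n _ => ⟨fun h' => absurd h' h, fun _ => ?_⟩⟩
        have := fun h0 => h (hiff.2 h0)
        exact le_antisymm (not_lt.1 this) zero_le
    choose N hN using hp
    exact ⟨Finset.univ.sup N, fun p => hN p _ (Finset.le_sup (Finset.mem_univ p))⟩
  have hAcov : proj1 E ⊆ ⋃ n, An n := by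
    intro x₁ hx₁
    by_contra hcon
    simp only [hAn, Set.mem_iUnion, Set.mem_ofPred_eq, not_exists, not_lt] at hcon
    have h0 : ∀ n, ∀ᵐ xr ∂(Measure.pi fun _ : Fin R => μ), xr ∉ secSet (En n) x₁ := fun n =>
      measure_eq_zero_iff_ae_notMem.1 (le_antisymm (hcon n) zero_le)
    refine (hsec x₁ hx₁).ne' (measure_eq_zero_iff_ae_notMem.2 ?_)
    filter_upwards [ae_all_iff.2 h0, hfin x₁] with xr h1 h2 h3
    obtain ⟨n, hn⟩ := hcover _ h3 h2
    exact h1 n hn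
  have hex : ∃ n, 0 < ψ (An n ×ˢ (Prod.fst '' Yp)) := by
    by_contra hcon
    simp only [not_exists, not_lt] at hcon
    refine hψ.ne' (measure_mono_null (t := ⋃ n, An n ×ˢ (Prod.fst '' Yp)) ?_
      (measure_iUnion_null fun n => le_antisymm (hcon n) zero_le))
    rintro ⟨x, i⟩ ⟨hx, hi⟩
    obtain ⟨n, hn⟩ := Set.mem_iUnion.1 (hAcov hx)
    exact Set.mem_iUnion.2 ⟨n, hn, hi⟩
  obtain ⟨n, hn⟩ := hex
  have hlo1 : lo n * lo n < 1 := by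
    have h1 : lo n < 1 := by
      rw [hlo]
      refine ENNReal.inv_lt_one.2 ?_
      exact lt_of_lt_of_le (by norm_num) le_add_self
    calc lo n * lo n ≤ lo n * 1 := by gcongr
      _ < 1 := by simpa using h1
  have hmul : ∀ i j, (i, j) ∈ Yp ↔ i ∈ Prod.fst '' Yp ∧ j ∈ Prod.snd '' Yp := by
    intro i j
    constructor
    · intro h; exact ⟨⟨_, h, rfl⟩, ⟨_, h, rfl⟩⟩
    · intro h; rw [hprod]; exact h
  refine ⟨En n, Finset.univ.filter (· ∈ Prod.snd '' Yp), lo n, n + 2, 1 - lo n * lo n, lo n * lo n,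
    hEnm n, ?_, tsub_add_cancel_of_le hlo1.le, ?_, by finiteness, tsub_pos_of_lt hlo1, ?_,
    An n ×ˢ (Prod.fst '' Yp), (hAnm n).prod (Set.toFinite _).measurableSet, hn, ?_⟩
  · intro x hx i
    by_cases hi : i ∈ Prod.fst '' Yp
    · right
      refine ⟨fun j hj => ?_, fun j hj => ?_⟩
      · exact (hx (i, j)).1 ((hmul i j).2 ⟨hi, by simpa using hj⟩)
      · refine (hx (i, j)).2 fun h => hj ?_
        have := ((hmul i j).1 h).2
        simpa using this
    · left
      intro j
      exact (hx (i, j)).2 fun h => hi ((hmul i j).1 h).1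
  · rw [mul_assoc, hlo, ENNReal.inv_mul_cancel (by simp) (by finiteness), mul_one]
  · exact ENNReal.sub_lt_self (by simp) (by simp) (ENNReal.mul_pos (hlo0 n).ne' (hlo0 n).ne').ne'
  · rintro ⟨x₁, i⟩ ⟨hx, hi⟩
    obtain ⟨⟨i', j⟩, hij, rfl⟩ := hi
    have hU : MeasurableSet {ω : ℕ → 𝓧 × 𝓨 | blk R (XP ω) ∈ En n} :=
      ((measurable_blk R).comp measurable_XP) (hEnm n)
    have h1 := dens hq hκ hF R (fun p => (En n).indicator (fun _ => 1) p.1)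
      ((measurable_const.indicator (hEnm n)).comp measurable_fst) (x₁, i')
    have h2 : Pz (x₁, i') {ω | blk R (XP ω) ∈ En n} =
        ∫⁻ ω, (En n).indicator (fun _ => (1 : ℝ≥0∞)) (fun k : Fin (R + 1) => (ω k).1) ∂(Pz (x₁, i')) := by
      rw [← lintegral_indicator_one hU]
      rfl
    change 0 < Pz (x₁, i') _
    rw [h2, h1]
    have hsm : MeasurableSet (secSet (En n) x₁) :=
      (measurable_fcons.comp (measurable_const.prodMk measurable_id)) (hEnm n)
    have h3 : 0 < lo n * (Measure.pi fun _ : Fin R => μ) (secSet (En n) x₁) :=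
      ENNReal.mul_pos (hlo0 n).ne' hx.ne'
    refine h3.trans_le ?_
    rw [← lintegral_indicator_one hsm, ← lintegral_const_mul _ (measurable_one.indicator hsm)]
    refine lintegral_mono fun xr => ?_
    by_cases hxr : xr ∈ secSet (En n) x₁
    · have hxr' : (Fin.cons x₁ xr : Fin (R + 1) → 𝓧) ∈ En n := hxr
      simp only [Set.indicator_of_mem hxr, Set.indicator_of_mem hxr', Pi.one_apply, mul_one]
      exact ((hxr' (i', j)).1 hij).1.trans (Finset.single_le_sum
        (f := fun j => pijD q (Fin.cons x₁ xr : Fin (R + 1) → 𝓧) i' j) (fun _ _ => zero_le)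
        (Finset.mem_univ j))
    · simp [Set.indicator_of_notMem hxr]

end ChooseE

section CondBounds

lemma obs_formula [MeasurableSingletonClass 𝓧] {κ : Kernel (𝓧 × 𝓨) (𝓧 × 𝓨)}
    {Pz : 𝓧 × 𝓨 → Measure (ℕ → 𝓧 × 𝓨)} (hF : IsMarkovFamily κ Pz)
    {P : Measure Ω} [IsProbabilityMeasure P] {Z : ℕ → Ω → 𝓧 × 𝓨} (h : IsMarkovChain P Z κ)
    {l s : ℕ} (hls : l ≤ s) {φ : (ℕ → 𝓧) → ℝ≥0∞} (hφ : Measurable φ)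
    {f : (ℕ → 𝓧 × 𝓨) → ℝ≥0∞} (hf : Measurable f) :
    ∫⁻ ω, φ (obsTail Z l ω) * f (fun k => Z (s + k) ω) ∂P =
      ∫⁻ ω, ∫⁻ ω', φ (glue (blk (s - l) (obsTail Z l ω)) (XP ω')) * f ω' ∂(Pz (Z s ω)) ∂P := by
  have h1 := markov_joint hF h s
    (Φ := fun p => φ (glue (blk (s - l) (fun k => (p.1 (l + k)).1)) (XP p.2)) * f p.2) (by
      have hm : Measurable fun p : (ℕ → 𝓧 × 𝓨) × (ℕ → 𝓧 × 𝓨) =>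
          blk (s - l) (fun k => (p.1 (l + k)).1) := by
        refine (measurable_blk (s - l)).comp ?_
        exact measurable_pi_lambda _ fun k =>
          measurable_fst.comp ((measurable_pi_apply (l + k)).comp measurable_fst)
      exact Measurable.mul (hφ.comp (measurable_glue.comp (hm.prodMk
        (measurable_XP.comp measurable_snd)))) (hf.comp measurable_snd))
  have e : ∀ ω, blk (s - l) (fun k => (Z (min (l + k) s) ω).1) = blk (s - l) (obsTail Z l ω) := by
    intro ω
    funext k
    simp only [blk, obsTail]
    rw [Nat.min_eq_left (by omega)]
  simp only [e] at h1
  rw [← h1]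
  refine lintegral_congr fun ω => ?_
  have e2 : XP (fun k => Z (s + k) ω) = fun k => obsTail Z l ω (s - l + k) := by
    funext k
    simp only [XP, obsTail]
    congr 2; omega
  rw [e2, glue_blk]

lemma measurable_obsTail {Z : ℕ → Ω → 𝓧 × 𝓨} (hZ : ∀ k, Measurable (Z k)) (l : ℕ) :
    Measurable (obsTail Z l) :=
  measurable_pi_lambda _ fun _ => measurable_fst.comp (hZ _)

lemma measurable_tailY {Z : ℕ → Ω → 𝓧 × 𝓨} (hZ : ∀ k, Measurable (Z k)) (l : ℕ) :
    Measurable (tailY Z l) :=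
  measurable_pi_lambda _ fun _ => measurable_snd.comp (hZ _)

lemma cond_bound [MeasurableSingletonClass 𝓧] {κ : Kernel (𝓧 × 𝓨) (𝓧 × 𝓨)}
    {Pz : 𝓧 × 𝓨 → Measure (ℕ → 𝓧 × 𝓨)} (hF : IsMarkovFamily κ Pz)
    {P : Measure Ω} [IsProbabilityMeasure P] {Z : ℕ → Ω → 𝓧 × 𝓨} (h : IsMarkovChain P Z κ)
    {l s t τ : ℕ} (hls : l ≤ s) (ht : t = s + τ) {A : Set (ℕ → 𝓨)} (hA : MeasurableSet A)
    {a b : (ℕ → 𝓧) → ℝ≥0∞} (hG : Good Pz A τ a b) :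
    ∀ᵐ ω ∂P, a (obsTail Z s ω) ≤ condLawTailInf P Z t l ω A ∧
      condLawTailInf P Z t l ω A ≤ b (obsTail Z s ω) := by
  obtain ⟨ha, hb, hab, hb1, H⟩ := hG
  have hX := measurable_obsTail h.1 l
  have hY := measurable_tailY h.1 t
  let sh : (ℕ → 𝓧) → ℕ → 𝓧 := fun w k => w (s - l + k)
  have hsh : Measurable sh := measurable_pi_lambda _ fun k => measurable_pi_apply _
  have esh : ∀ ω, sh (obsTail Z l ω) = obsTail Z s ω := by
    intro ω; funext k
    simp only [sh, obsTail]
    congr 2; omega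
  let K := condDistrib (tailY Z t) (obsTail Z l) P
  have hK : Measurable fun w => K w A := K.measurable_coe hA
  have := Measure.isProbabilityMeasure_map (μ := P) hX.aemeasurable
  have hind : Measurable fun ω : ℕ → 𝓧 × 𝓨 => A.indicator (fun _ => (1 : ℝ≥0∞)) (YT τ ω) :=
    (measurable_const.indicator hA).comp (measurable_YT τ)
  -- integrals over sets
  have mid : ∀ D : Set (ℕ → 𝓧), MeasurableSet D →
      ∫⁻ w in D, K w A ∂(P.map (obsTail Z l)) =
        ∫⁻ ω, ∫⁻ ω', D.indicator (fun _ => 1) (glue (blk (s - l) (obsTail Z l ω)) (XP ω')) *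
          A.indicator (fun _ => 1) (YT τ ω') ∂(Pz (Z s ω)) ∂P := by
    intro D hD
    rw [setLIntegral_map hD hK hX, setLIntegral_preimage_condDistrib hX hY.aemeasurable hA hD,
      ← obs_formula hF h hls (measurable_const.indicator hD) hind,
      ← lintegral_indicator_one ((hX hD).inter (hY hA))]
    refine lintegral_congr fun ω => ?_
    have e : YT τ (fun k => Z (s + k) ω) = tailY Z t ω := by
      funext k
      simp only [YT, tailY, ht]
      congr 2; omega
    rw [e]
    by_cases h1 : obsTail Z l ω ∈ D <;> by_cases h2 : tailY Z t ω ∈ A <;>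
      simp [Set.indicator, h1, h2]
  have side : ∀ f : (ℕ → 𝓧) → ℝ≥0∞, Measurable f → ∀ D : Set (ℕ → 𝓧), MeasurableSet D →
      ∫⁻ w in D, f (sh w) ∂(P.map (obsTail Z l)) =
        ∫⁻ ω, ∫⁻ ω', D.indicator (fun _ => 1) (glue (blk (s - l) (obsTail Z l ω)) (XP ω')) *
          f (XP ω') ∂(Pz (Z s ω)) ∂P := by
    intro f hf D hD
    have hfs : Measurable fun w => f (sh w) := hf.comp hsh
    have hfx : Measurable fun w : ℕ → 𝓧 × 𝓨 => f (XP w) := hf.comp measurable_XP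
    rw [← lintegral_indicator hD, lintegral_map (hfs.indicator hD) hX,
      ← obs_formula hF h hls (measurable_const.indicator hD) hfx]
    refine lintegral_congr fun ω => ?_
    have e : XP (fun k => Z (s + k) ω) = obsTail Z s ω := rfl
    rw [e, ← esh]
    by_cases h1 : obsTail Z l ω ∈ D <;> simp [Set.indicator, h1]
  have hφ : ∀ (D : Set (ℕ → 𝓧)), MeasurableSet D → ∀ x : Fin (s - l + 1) → 𝓧,
      Measurable fun w => D.indicator (fun _ => (1 : ℝ≥0∞)) (glue x w) := fun D hD x =>
    (measurable_const.indicator hD).comp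
      (measurable_glue.comp (measurable_const.prodMk measurable_id))
  have hφ1 : ∀ (D : Set (ℕ → 𝓧)) (x : Fin (s - l + 1) → 𝓧) (w : ℕ → 𝓧),
      D.indicator (fun _ => (1 : ℝ≥0∞)) (glue x w) ≤ 1 := by
    intro D x w
    by_cases h1 : glue x w ∈ D <;> simp [h1]
  have lower : ∀ᵐ w ∂(P.map (obsTail Z l)), a (sh w) ≤ K w A := by
    refine ae_le_of_forall_setLIntegral_le_of_sigmaFinite (ha.comp hsh) fun D hD _ => ?_
    rw [mid D hD]
    refine (side a ha D hD).trans_le (lintegral_mono fun ω => ?_)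
    exact (H (Z s ω) (fun w => D.indicator (fun _ => 1) (glue (blk (s - l) (obsTail Z l ω)) w))
      (hφ D hD _) (hφ1 D _)).1
  have upper : ∀ᵐ w ∂(P.map (obsTail Z l)), K w A ≤ b (sh w) := by
    refine ae_le_of_forall_setLIntegral_le_of_sigmaFinite hK fun D hD _ => ?_
    rw [mid D hD]
    refine le_trans (lintegral_mono fun ω => ?_) (side b hb D hD).ge
    exact (H (Z s ω) (fun w => D.indicator (fun _ => 1) (glue (blk (s - l) (obsTail Z l ω)) w))
      (hφ D hD _) (hφ1 D _)).2
  filter_upwards [ae_of_ae_map hX.aemeasurable lower, ae_of_ae_map hX.aemeasurable upper]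
    with ω h1 h2
  rw [esh] at h1 h2
  exact ⟨h1, h2⟩

/-- Approximation: a bound on a generating algebra extends to all measurable sets. -/
lemma tv_of_algebra {W : Type*} [mW : MeasurableSpace W] {C : Set (Set W)}
    (hC : IsSetAlgebra C) (hgen : mW = MeasurableSpace.generateFrom C)
    {ρ₁ ρ₂ : Measure W} [IsFiniteMeasure ρ₁] [IsFiniteMeasure ρ₂] {ε : ℝ≥0∞}
    (h12 : ∀ A ∈ C, ρ₁ A ≤ ρ₂ A + ε) (h21 : ∀ A ∈ C, ρ₂ A ≤ ρ₁ A + ε) :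
    tvDistM ρ₁ ρ₂ ≤ 2 * ε := by
  have hCm : ∀ A ∈ C, MeasurableSet A := fun A hA =>
    hgen ▸ MeasurableSpace.measurableSet_generateFrom hA
  have main : ∀ (σ₁ σ₂ : Measure W) [IsFiniteMeasure σ₁] [IsFiniteMeasure σ₂],
      (∀ A ∈ C, σ₁ A ≤ σ₂ A + ε) → ∀ A, MeasurableSet A → σ₁ A - σ₂ A ≤ ε := by
    intro σ₁ σ₂ _ _ hh A hA
    rw [tsub_le_iff_left]
    refine ENNReal.le_of_forall_pos_le_add fun η hη _ => ?_
    obtain ⟨B, hB, hlt⟩ := exists_measure_symmDiff_lt_of_generateFrom_isSetRing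
      (μ := σ₁ + σ₂) hC.isSetRing
      ⟨{Set.univ}, Set.countable_singleton _, by simpa using hC.univ_mem, by simp⟩ hgen hA
      (ENNReal.coe_pos.2 hη)
    rw [Measure.add_apply] at hlt
    have e1 : σ₁ A ≤ σ₁ B + σ₁ (symmDiff B A) := by
      refine (measure_mono (t := B ∪ symmDiff B A) ?_).trans (measure_union_le _ _)
      intro x hx
      by_cases hxB : x ∈ B
      · exact Or.inl hxB
      · exact Or.inr (Or.inr ⟨hx, hxB⟩)
    have e2 : σ₂ B ≤ σ₂ A + σ₂ (symmDiff B A) := by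
      refine (measure_mono (t := A ∪ symmDiff B A) ?_).trans (measure_union_le _ _)
      intro x hx
      by_cases hxB : x ∈ A
      · exact Or.inl hxB
      · exact Or.inr (Or.inl ⟨hx, hxB⟩)
    calc σ₁ A ≤ σ₁ B + σ₁ (symmDiff B A) := e1
      _ ≤ (σ₂ B + ε) + σ₁ (symmDiff B A) := by gcongr; exact hh B hB
      _ ≤ ((σ₂ A + σ₂ (symmDiff B A)) + ε) + σ₁ (symmDiff B A) := by gcongr
      _ = σ₂ A + ε + (σ₁ (symmDiff B A) + σ₂ (symmDiff B A)) := by ring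
      _ ≤ σ₂ A + ε + η := by gcongr
  unfold tvDistM
  gcongr
  refine iSup₂_le fun A hA => sup_le (main ρ₁ ρ₂ h12 A hA) (main ρ₂ ρ₁ h21 A hA)

lemma tv_bound [StandardBorelSpace 𝓧] {κ : Kernel (𝓧 × 𝓨) (𝓧 × 𝓨)} {μ : Measure 𝓧} [SigmaFinite μ]
    {q : 𝓧 × 𝓨 → 𝓧 × 𝓨 → ℝ≥0∞} (hq : Measurable (Function.uncurry q))
    (hκ : ∀ z : 𝓧 × 𝓨, (κ z : Measure (𝓧 × 𝓨)) =
      (μ.prod Measure.count).withDensity (fun z' => q z' z))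
    {Pz : 𝓧 × 𝓨 → Measure (ℕ → 𝓧 × 𝓨)} (hF : IsMarkovFamily κ Pz) {R : ℕ}
    {E : Set (Fin (R + 1) → 𝓧)} (hE : MeasurableSet E) (Y2 : Finset 𝓨) {lo M ρ δ : ℝ≥0∞}
    (hEp : ∀ x ∈ E, ∀ i, (∀ j, pijD q x i j = 0) ∨
      ((∀ j ∈ Y2, lo ≤ pijD q x i j ∧ pijD q x i j ≤ M) ∧ ∀ j ∉ Y2, pijD q x i j = 0))
    (hρ : ρ + δ = 1) (hδ : δ * M ≤ lo) (hM : M ≠ ∞)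
    {P : Measure Ω} [IsProbabilityMeasure P] {Z : ℕ → Ω → 𝓧 × 𝓨} (h : IsMarkovChain P Z κ)
    {l s : ℕ} (hls : l ≤ s) (r u τ : ℕ) {t : ℕ} (ht : t = s + (r + (u * R + τ))) :
    ∀ᵐ ω ∂P, tvDistM (condLawTailInf P Z t l ω) (condLawTailInf P Z t s ω) ≤
      2 * ρ ^ nblk E u (fun k => obsTail Z s ω (r + k)) := by
  let G : Set (Set (ℕ → 𝓨)) := MeasurableSpace.countableGeneratingSet (ℕ → 𝓨)
  let C : Set (Set (ℕ → 𝓨)) := generateSetAlgebra G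
  have hGc : G.Countable := MeasurableSpace.countable_countableGeneratingSet
  have hCc : C.Countable := countable_generateSetAlgebra hGc
  have hCa : IsSetAlgebra C := isSetAlgebra_generateSetAlgebra
  have hgen : (MeasurableSpace.pi : MeasurableSpace (ℕ → 𝓨)) = MeasurableSpace.generateFrom C := by
    rw [generateFrom_generateSetAlgebra_eq, MeasurableSpace.generateFrom_countableGeneratingSet]
  have hCm : ∀ A ∈ C, MeasurableSet A := fun A hA => by
    rw [hgen]; exact MeasurableSpace.measurableSet_generateFrom hA
  have key : ∀ A ∈ C, ∀ᵐ ω ∂P, condLawTailInf P Z t l ω A ≤ condLawTailInf P Z t s ω A +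
        ρ ^ nblk E u (fun k => obsTail Z s ω (r + k)) ∧
      condLawTailInf P Z t s ω A ≤ condLawTailInf P Z t l ω A +
        ρ ^ nblk E u (fun k => obsTail Z s ω (r + k)) := by
    intro A hA
    obtain ⟨a, b, hG, hab⟩ := block_iter hq hκ hF hE Y2 hEp hρ hδ hM (hCm A hA) r u τ
    filter_upwards [cond_bound hF h hls ht (hCm A hA) hG,
      cond_bound hF h le_rfl ht (hCm A hA) hG] with ω h1 h2
    constructor
    · exact h1.2.trans ((hab _).trans (by gcongr; exact h2.1))
    · exact h2.2.trans ((hab _).trans (by gcongr; exact h1.1))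
  filter_upwards [(ae_ball_iff hCc).2 key] with ω hω
  have i1 : IsProbabilityMeasure (condLawTailInf P Z t l ω) := by
    unfold condLawTailInf; infer_instance
  have i2 : IsProbabilityMeasure (condLawTailInf P Z t s ω) := by
    unfold condLawTailInf; infer_instance
  exact tv_of_algebra hCa hgen (fun A hA => (hω A hA).1) (fun A hA => (hω A hA).2)

end CondBounds

section Final

lemma measurable_nblk {R : ℕ} {E : Set (Fin (R + 1) → 𝓧)} (hE : MeasurableSet E) (u : ℕ) :
    Measurable (nblk E u : (ℕ → 𝓧) → ℕ) := by
  unfold nblk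
  refine Finset.measurable_fun_sum _ fun v _ => ?_
  refine (measurable_const.indicator hE).comp ((measurable_blk R).comp ?_)
  exact measurable_pi_lambda _ fun k => measurable_pi_apply _

/-- The total count is the sum of the counts along residue classes. -/
lemma cnt_eq_sum {R : ℕ} (E : Set (Fin (R + 1) → 𝓧)) (u : ℕ) (ω : ℕ → 𝓧 × 𝓨) :
    cnt {ω | blk R (XP ω) ∈ E} (u * R) ω =
      ((∑ r ∈ Finset.range R, nblk E u (fun k => XP ω (r + k)) : ℕ) : ℝ) := by
  have e : ∀ k, Set.indicator {ω : ℕ → 𝓧 × 𝓨 | blk R (XP ω) ∈ E} (1 : (ℕ → 𝓧 × 𝓨) → ℝ)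
      (fun i => ω (k + i)) =
      ((E.indicator (fun _ => 1) (blk R fun i => XP ω (k + i)) : ℕ) : ℝ) := by
    intro k
    have e1 : XP (fun i => ω (k + i)) = fun i => XP ω (k + i) := rfl
    by_cases h : (blk R fun i => XP ω (k + i)) ∈ E
    · simp [Set.indicator, e1, h]
    · simp [Set.indicator, e1, h]
  have e2 : cnt {ω : ℕ → 𝓧 × 𝓨 | blk R (XP ω) ∈ E} (u * R) ω =
      ((∑ k ∈ Finset.range (u * R), E.indicator (fun _ => 1) (blk R fun i => XP ω (k + i)) : ℕ) : ℝ) := by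
    rw [Nat.cast_sum]
    exact Finset.sum_congr rfl fun k _ => e k
  rw [e2]
  congr 1
  induction u with
  | zero => simp [nblk]
  | succ u ih =>
    rw [Nat.succ_mul, Finset.sum_range_add, ih ?_, ← Finset.sum_add_distrib]
    · refine Finset.sum_congr rfl fun r _ => ?_
      simp only [nblk, Finset.sum_range_succ]
      congr 3
      funext i
      congr 1
      omega
    · rw [Nat.cast_sum]
      exact Finset.sum_congr rfl fun k _ => e k

lemma exists_residue {R : ℕ} (hR : 1 ≤ R) (E : Set (Fin (R + 1) → 𝓧)) {c : ℝ} (hc0 : 0 < c)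
    {ω : ℕ → 𝓧 × 𝓨} (hω : ω ∈ linEv {ω | blk R (XP ω) ∈ E} c) :
    ∃ K : ℕ, ∀ n : ℕ, ∃ r : Fin R,
      c / R * n ≤ nblk E (n / R - 1) (fun k => XP ω (r + k)) + K := by
  obtain ⟨K, hK⟩ := hω
  refine ⟨K + ⌈2 * c⌉₊, fun n => ?_⟩
  set u := n / R - 1 with hu
  have hRpos : (0 : ℝ) < R := by exact_mod_cast hR
  have h1 := hK (u * R)
  rw [cnt_eq_sum] at h1
  have hne : (Finset.range R).Nonempty := ⟨0, by simp; omega⟩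
  obtain ⟨r, hr, hmax⟩ := Finset.exists_max_image (Finset.range R)
    (fun r => nblk E u (fun k => XP ω (r + k))) hne
  refine ⟨⟨r, Finset.mem_range.1 hr⟩, ?_⟩
  have h2 : (∑ r ∈ Finset.range R, nblk E u (fun k => XP ω (r + k)))
      ≤ R * nblk E u (fun k => XP ω (r + k)) := by
    have := Finset.sum_le_card_nsmul (Finset.range R) _ _ hmax
    simpa using this
  have h2' : ((∑ r ∈ Finset.range R, nblk E u (fun k => XP ω (r + k)) : ℕ) : ℝ)
      ≤ R * nblk E u (fun k => XP ω (r + k)) := by exact_mod_cast h2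
  have h3 : n ≤ (u + 2) * R := by
    have a1 := Nat.div_add_mod n R
    have a2 := Nat.mod_lt n (show 0 < R by omega)
    have a3 : n / R ≤ u + 1 := by omega
    have a4 : R * (n / R) ≤ R * (u + 1) := Nat.mul_le_mul_left _ a3
    nlinarith
  have h3' : (n : ℝ) ≤ (u + 2) * R := by exact_mod_cast h3
  have h4 : 2 * c ≤ ⌈2 * c⌉₊ := Nat.le_ceil _
  have h5 : (n : ℝ) / R ≤ u + 2 := by rw [div_le_iff₀ hRpos]; exact h3'
  have h6 : c / R * n ≤ c * u + 2 * c := by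
    calc c / R * n = c * (n / R) := by ring
      _ ≤ c * (u + 2) := by gcongr
      _ = _ := by ring
  have h7 : c * u ≤ nblk E u (fun k => XP ω (r + k)) + K := by
    push_cast at h1
    have hRK : (K : ℝ) ≤ R * K := by
      have : (1 : ℝ) ≤ R := by exact_mod_cast hR
      nlinarith [(Nat.cast_nonneg K : (0 : ℝ) ≤ K)]
    have : R * (c * u) ≤ R * (nblk E u (fun k => XP ω (r + k)) + K) := by
      push_cast at h2'
      nlinarith
    exact le_of_mul_le_mul_left this hRpos
  push_cast
  change c / R * n ≤ nblk E u (fun k => XP ω (r + k)) + (K + (⌈2 * c⌉₊ : ℝ))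
  linarith

lemma measurable_obsTail_sigma (Z : ℕ → Ω → 𝓧 × 𝓨) (s : ℕ) :
    Measurable[obsSigmaFrom Z s] (obsTail Z s) := by
  refine @measurable_pi_lambda _ _ _ (obsSigmaFrom Z s) _ _ fun k => ?_
  refine measurable_iff_comap_le.2 ?_
  exact le_iSup₂_of_le (f := fun i (_ : i ∈ Set.Ici s) =>
    MeasurableSpace.comap (fun ω => (Z i ω).1) inferInstance) (s + k) (by simp) le_rfl

end Final

/-- If the PMM `Z` satisfies **A1**, **A2** and is positive Harris, then
there is `α ∈ (0,1)` such that for every `s` there is a `σ(X_{s:∞})`-measurable random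
variable `C_s < ∞` with, for all `t ≥ s ≥ l`, almost surely
`‖P(Y_{t:∞} ∈ · | X_{l:∞}) − P(Y_{t:∞} ∈ · | X_{s:∞})‖_TV ≤ C_s α^{t−s}`,
the conditional distributions being regular versions given the full observation
σ-fields `σ(X_{l:∞})`, `σ(X_{s:∞})`. -/
theorem exponential_forgetting_full_observation
    [TopologicalSpace 𝓧] [PolishSpace 𝓧] [BorelSpace 𝓧]
    (P : Measure Ω) [IsProbabilityMeasure P]
    (Z : ℕ → Ω → 𝓧 × 𝓨) (κ : Kernel (𝓧 × 𝓨) (𝓧 × 𝓨)) (μ : Measure 𝓧)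
    (q : 𝓧 × 𝓨 → 𝓧 × 𝓨 → ℝ≥0∞) (p0 : 𝓧 × 𝓨 → ℝ≥0∞)
    (Pz : 𝓧 × 𝓨 → Measure (ℕ → 𝓧 × 𝓨)) (ψ : Measure (𝓧 × 𝓨))
    {R : ℕ} (E : Set (Fin (R + 1) → 𝓧)) (Yp : Set (𝓨 × 𝓨))
    (hPMM : IsPMM P Z κ μ q p0)
    (hA1 : Assumption1 q E Yp) (hA2 : Assumption2 κ ψ μ E Yp)
    (hFam : IsMarkovFamily κ Pz) (hHarris : HarrisProp κ Pz ψ)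
    (hPos : IsPositive κ) :
    ∃ α : ℝ, 0 < α ∧ α < 1 ∧ ∀ s : ℕ, ∃ C : Ω → ℝ,
      Measurable[obsSigmaFrom Z s] C ∧
      ∀ l t : ℕ, l ≤ s → s ≤ t → ∀ᵐ ω ∂P,
        tvDistM (condLawTailInf P Z t l ω) (condLawTailInf P Z t s ω)
          ≤ ENNReal.ofReal (C ω * α ^ (t - s)) := by
  obtain ⟨-, hMC, hσ, hq, -, hκ, -⟩ := hPMM
  have hR : 1 ≤ R := hA1.1
  obtain ⟨E', Y2, lo, M, ρ, δ, hE', hEp, hρδ, hδ, hM, hρ0, hρ1, B, hB, hψB, hBU⟩ :=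
    choose_E hq hκ hFam hA1 hA2
  have hU : MeasurableSet {ω : ℕ → 𝓧 × 𝓨 | blk R (XP ω) ∈ E'} :=
    ((measurable_blk R).comp measurable_XP) hE'
  obtain ⟨c, hc0, hc1, hlin⟩ := linear_growth hFam hHarris hPos hU hB hψB hBU
  have hRpos : (0 : ℝ) < R := by exact_mod_cast hR
  have hρtop : ρ ≠ ∞ := (hρ1.trans ENNReal.one_lt_top).ne
  set p : ℝ := ρ.toReal with hp
  have hp0 : 0 < p := ENNReal.toReal_pos hρ0.ne' hρtop
  have hp1 : p < 1 := by
    rw [hp, ← ENNReal.toReal_one]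
    exact (ENNReal.toReal_lt_toReal hρtop ENNReal.one_ne_top).2 hρ1
  have hρp : ρ = ENNReal.ofReal p := (ENNReal.ofReal_toReal hρtop).symm
  have hcR : 0 < c / R := div_pos hc0 hRpos
  set α : ℝ := p ^ (c / R) with hα
  have hα0 : 0 < α := Real.rpow_pos_of_pos hp0 _
  have hα1 : α < 1 := Real.rpow_lt_one hp0.le hp1 hcR
  refine ⟨α, hα0, hα1, fun s => ?_⟩
  let W : ℕ → (ℕ → 𝓧) → ℝ≥0∞ := fun n w =>
    ⨅ r : Fin R, 2 * ρ ^ nblk E' (n / R - 1) (fun k => w (r + k))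
  have hW : ∀ n, Measurable (W n) := by
    intro n
    refine Measurable.iInf fun r => measurable_const.mul ?_
    have : Measurable fun w : ℕ → 𝓧 => nblk E' (n / R - 1) (fun k => w (r + k)) :=
      (measurable_nblk hE' _).comp (measurable_pi_lambda _ fun k => measurable_pi_apply _)
    exact (Measurable.of_discrete (f := fun m : ℕ => ρ ^ m)).comp this
  let D : (ℕ → 𝓧) → ℝ≥0∞ := fun w => ⨆ n : ℕ, W n w / ENNReal.ofReal (α ^ n)
  have hD : Measurable D := Measurable.iSup fun n => (hW n).div_const _
  refine ⟨fun ω => (D (obsTail Z s ω)).toReal,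
    (hD.ennreal_toReal).comp (measurable_obsTail_sigma Z s), fun l t hls hst => ?_⟩
  -- almost sure finiteness
  have hae : ∀ᵐ ω ∂P, (fun k => Z (s + k) ω) ∈ linEv {ω : ℕ → 𝓧 × 𝓨 | blk R (XP ω) ∈ E'} c := by
    have hL := measurableSet_linEv hU c
    have h1 := markov_path hFam hMC s (C := Set.univ) MeasurableSet.univ hL.compl
    have h2 : ∀ z, Pz z (linEv {ω : ℕ → 𝓧 × 𝓨 | blk R (XP ω) ∈ E'} c)ᶜ = 0 := fun z => hlin z
    simp only [h2, lintegral_zero, Set.inter_univ] at h1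
    exact h1
  have hfin : ∀ w : ℕ → 𝓧 × 𝓨, w ∈ linEv {ω : ℕ → 𝓧 × 𝓨 | blk R (XP ω) ∈ E'} c →
      D (XP w) ≠ ∞ := by
    intro w hw
    obtain ⟨K, hK⟩ := exists_residue hR E' hc0 hw
    refine ne_top_of_le_ne_top (b := ENNReal.ofReal (2 * (p ^ K)⁻¹)) ENNReal.ofReal_ne_top ?_
    refine iSup_le fun n => ?_
    obtain ⟨r, hr⟩ := hK n
    refine ENNReal.div_le_of_le_mul ?_
    refine (iInf_le _ r).trans ?_
    rw [hρp, ← ENNReal.ofReal_pow hp0.le, ← ENNReal.ofReal_mul (by positivity),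
      show (2 : ℝ≥0∞) = ENNReal.ofReal 2 by simp, ← ENNReal.ofReal_mul (by norm_num)]
    refine ENNReal.ofReal_le_ofReal ?_
    set N := nblk E' (n / R - 1) (fun k => XP w (r + k)) with hN
    have e1 : α ^ n = p ^ (c / R * n) := by
      rw [hα, Real.rpow_mul hp0.le, Real.rpow_natCast]
    have e2 : p ^ (N + K) ≤ α ^ n := by
      rw [e1, ← Real.rpow_natCast]
      refine Real.rpow_le_rpow_of_exponent_ge hp0 hp1.le ?_
      push_cast
      exact hr
    have hpK : 0 < p ^ K := by positivity
    rw [pow_add] at e2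
    calc 2 * p ^ N = 2 * (p ^ K)⁻¹ * (p ^ N * p ^ K) := by field_simp
      _ ≤ 2 * (p ^ K)⁻¹ * α ^ n := by gcongr
  have htv : ∀ᵐ ω ∂P, ∀ r : Fin R,
      tvDistM (condLawTailInf P Z t l ω) (condLawTailInf P Z t s ω) ≤
        2 * ρ ^ nblk E' ((t - s) / R - 1) (fun k => obsTail Z s ω (r + k)) := by
    rw [ae_all_iff]
    intro r
    by_cases hn : (t - s) / R - 1 = 0
    · have := tv_bound hq hκ hFam hE' Y2 hEp hρδ hδ hM hMC hls 0 0 (t - s) (t := t) (by omega)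
      filter_upwards [this] with ω hω
      rw [hn]
      simpa [nblk] using hω
    · have h1 : r + ((t - s) / R - 1) * R ≤ t - s := by
        have a1 := Nat.div_mul_le_self (t - s) R
        have a2 : (t - s) / R = ((t - s) / R - 1) + 1 := by omega
        have a3 := r.2
        have a4 : ((t - s) / R - 1 + 1) * R ≤ t - s := by rw [← a2]; exact a1
        rw [Nat.succ_mul] at a4
        omega
      exact tv_bound hq hκ hFam hE' Y2 hEp hρδ hδ hM hMC hls r ((t - s) / R - 1)
        (t - s - (r + ((t - s) / R - 1) * R)) (by omega)
  filter_upwards [hae, htv] with ω h1 h2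
  have h3 : D (obsTail Z s ω) ≠ ∞ := hfin (fun k => Z (s + k) ω) h1
  rw [ENNReal.ofReal_mul ENNReal.toReal_nonneg, ENNReal.ofReal_toReal h3]
  have h4 : tvDistM (condLawTailInf P Z t l ω) (condLawTailInf P Z t s ω) ≤
      W (t - s) (obsTail Z s ω) := le_iInf h2
  have h5 : W (t - s) (obsTail Z s ω) / ENNReal.ofReal (α ^ (t - s)) ≤ D (obsTail Z s ω) :=
    le_iSup (fun n : ℕ => W n (obsTail Z s ω) / ENNReal.ofReal (α ^ n)) (t - s)
  refine h4.trans ?_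
  rwa [ENNReal.div_le_iff (by simpa using pow_pos hα0 _) ENNReal.ofReal_ne_top] at h5

end PMMPaper
end

section
/- Let Z be a PMM satisfying assumptions A1 and A2 with set E ⊂ X^r, and suppose 1/n₀ ≤ p_{ij}(x_{1:r}) ≤ n₀ for all (i,j) ∈ Y⁺ and x_{1:r} ∈ E. Then for every z = (x₁,i) ∈ E_(1) × Y⁺_(1) one has P_z(X_{1:r} ∈ E) > 0; in fact P_{(x₁,i)}(X_{1:r} ∈ E) ≥ (|Y⁺_(2)|/n₀) · μ^{r-1}(E(x₁)) > 0. -/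
open MeasureTheory ProbabilityTheory ENNReal

namespace PMMPaper

/-! ### Pairwise Markov models -/

variable {𝓧 : Type*} [MeasurableSpace 𝓧] {𝓨 : Type*} [Fintype 𝓨] [DecidableEq 𝓨]
  [MeasurableSpace 𝓨] [MeasurableSingletonClass 𝓨] [Nonempty 𝓨]
  {Ω : Type*} [MeasurableSpace Ω]

/-! ### Auxiliary results for the proof -/

section Aux

/-- The outer measure of the preimage of an arbitrary set is the outer measure under the law. -/
theorem aux_map_le {Ω' β : Type*} [MeasurableSpace Ω'] [StandardBorelSpace Ω']
    [MeasurableSpace β] [StandardBorelSpace β]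
    (P : Measure Ω') [IsProbabilityMeasure P] (X : Ω' → β) (hX : Measurable X) (E : Set β) :
    P.map X E ≤ P (X ⁻¹' E) := by
  have : Nonempty Ω' := nonempty_of_isProbabilityMeasure P
  set B := toMeasurable P (X ⁻¹' E) with hB
  have hBm : MeasurableSet B := measurableSet_toMeasurable _ _
  rw [← measure_toMeasurable (X ⁻¹' E)]
  have hcd : P.map X ⊗ₘ condDistrib id X P = P.map (fun ω => (X ω, id ω)) :=
    compProd_map_condDistrib aemeasurable_id
  have hm : Measurable (fun ω => (X ω, id ω)) := hX.prodMk measurable_id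
  have hPB : P B = ∫⁻ x, condDistrib id X P x B ∂(P.map X) := by
    have h1 := congrArg (fun m => m (Prod.snd ⁻¹' B)) hcd
    rw [Measure.compProd_apply (measurable_snd hBm), Measure.map_apply hm (measurable_snd hBm)] at h1
    exact h1.symm
  have hdiag : MeasurableSet {p : β × Ω' | X p.2 = p.1} :=
    measurableSet_eq_fun (hX.comp measurable_snd) measurable_fst
  have hae : ∀ᵐ p ∂(P.map X ⊗ₘ condDistrib id X P), X p.2 = p.1 := by
    rw [hcd, ae_map_iff hm.aemeasurable hdiag]
    simp
  have hae2 := Measure.ae_ae_of_ae_compProd hae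
  have hK : Measurable (fun x => condDistrib id X P x B) := Kernel.measurable_coe _ hBm
  calc P.map X E ≤ P.map X {x | 1 ≤ condDistrib id X P x B} := by
        apply measure_mono_ae
        filter_upwards [hae2] with x hx hxE
        have hxE : x ∈ E := hxE
        show 1 ≤ condDistrib id X P x B
        have : ∀ᵐ ω ∂(condDistrib id X P x), ω ∈ B := by
          filter_upwards [hx] with ω hω
          apply subset_toMeasurable
          show X ω ∈ E
          rwa [hω]
        exact (prob_compl_eq_zero_iff hBm).1 this |>.ge
    _ ≤ ∫⁻ x, condDistrib id X P x B ∂(P.map X) := by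
        simpa using mul_meas_ge_le_lintegral (μ := P.map X) hK 1
    _ = P B := hPB.symm

variable {S : Type*} [MeasurableSpace S]

/-- The kernel of a Markov family is a Markov kernel. -/
theorem aux_markov [MeasurableSingletonClass S] (κ : Kernel S S) (Pz : S → Measure (ℕ → S))
    (h : IsMarkovFamily κ Pz) : IsMarkovKernel κ := by
  refine ⟨fun z => ⟨?_⟩⟩
  have := h.1 z
  have h1 := h.2.2 z 0 (fun _ => 1) measurable_const Set.univ MeasurableSet.univ
  have h0 : ∀ᵐ ω ∂(Pz z), ω 0 = z := by
    have hm : MeasurableSet {ω : ℕ → S | ω 0 = z} :=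
      (measurable_pi_apply (X := fun _ : ℕ => S) 0) (measurableSet_singleton z)
    exact (prob_compl_eq_zero_iff hm).2 (h.2.1 z)
  simp only [Measure.restrict_univ, lintegral_const, measure_univ, one_mul] at h1
  rw [h1, lintegral_congr_ae (g := fun _ => κ z Set.univ)]
  · simp
  · filter_upwards [h0] with ω hω
    simp [hω]

/-- Joint form of the Markov property. -/
theorem aux_step [MeasurableSingletonClass S] (κ : Kernel S S) (Pz : S → Measure (ℕ → S))
    (h : IsMarkovFamily κ Pz) (z : S) (n : ℕ) (g : (Fin (n + 1) → S) × S → ℝ≥0∞)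
    (hg : Measurable g) :
    ∫⁻ ω, g (fun k : Fin (n + 1) => ω k, ω (n + 1)) ∂(Pz z) =
      ∫⁻ ω, ∫⁻ z', g (fun k : Fin (n + 1) => ω k, z') ∂(κ (ω n)) ∂(Pz z) := by
  have := h.1 z
  have := aux_markov κ Pz h
  let H : (ℕ → S) → (Fin (n + 1) → S) := fun ω k => ω k
  have hH : Measurable H := measurable_pi_lambda _ fun k => measurable_pi_apply _
  let L : (Fin (n + 1) → S) → S := fun v => v (Fin.last n)
  have hL : Measurable L := measurable_pi_apply _
  have hHn : Measurable (fun ω : ℕ → S => (H ω, ω (n + 1))) :=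
    hH.prodMk (measurable_pi_apply _)
  have key : (Pz z).map (fun ω : ℕ → S => (H ω, ω (n + 1))) =
      (Pz z).map H ⊗ₘ (κ.comap L hL) := by
    have : IsFiniteMeasure ((Pz z).map (fun ω : ℕ → S => (H ω, ω (n + 1)))) := by
      infer_instance
    apply Measure.ext_prod
    intro s t hs ht
    rw [Measure.map_apply hHn (hs.prod ht), Measure.compProd_apply_prod hs ht,
      setLIntegral_map hs (Kernel.measurable_coe _ ht) hH]
    have hC : MeasurableSet[⨆ i ∈ Set.Iic n,
        MeasurableSpace.comap (fun ω : ℕ → S => ω i) inferInstance] (H ⁻¹' s) := by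
      have : @Measurable _ _ (⨆ i ∈ Set.Iic n,
        MeasurableSpace.comap (fun ω : ℕ → S => ω i) inferInstance) _ H := by
        refine @measurable_pi_lambda _ _ _ (⨆ i ∈ Set.Iic n,
          MeasurableSpace.comap (fun ω : ℕ → S => ω i) inferInstance) _ _ fun k => ?_
        refine Measurable.mono (comap_measurable (fun ω : ℕ → S => ω (k : ℕ))) ?_ le_rfl
        exact le_iSup₂_of_le (k : ℕ) (Set.mem_Iic.2 (Nat.lt_succ_iff.1 k.2)) le_rfl
      exact this hs
    have hmk := h.2.2 z n (t.indicator 1) (measurable_one.indicator ht) (H ⁻¹' s) hC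
    simp only [lintegral_indicator_one ht] at hmk
    have hl : ∀ ω : ℕ → S, t.indicator (1 : S → ℝ≥0∞) (ω (n + 1)) =
        ((fun ω : ℕ → S => ω (n + 1)) ⁻¹' t).indicator 1 ω := fun ω => rfl
    simp_rw [hl] at hmk
    rw [lintegral_indicator_one (measurable_pi_apply (n + 1) ht),
      Measure.restrict_apply (measurable_pi_apply (n + 1) ht), Set.inter_comm] at hmk
    exact hmk
  have e1 : ∫⁻ ω, g (fun k : Fin (n + 1) => ω k, ω (n + 1)) ∂(Pz z) =
      ∫⁻ p, g p ∂((Pz z).map (fun ω : ℕ → S => (H ω, ω (n + 1)))) :=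
    (lintegral_map hg hHn).symm
  rw [e1, key, Measure.lintegral_compProd hg, lintegral_map _ hH]
  · rfl
  · exact Measurable.lintegral_kernel_prod_right' hg

/-- Product of transition densities along a string. -/
noncomputable def auxD (q : S → S → ℝ≥0∞) {n : ℕ} (w : Fin (n + 1) → S) : ℝ≥0∞ :=
  ∏ k : Fin n, q (w k.succ) (w k.castSucc)

theorem aux_measurable_D (q : S → S → ℝ≥0∞) (hq : Measurable (Function.uncurry q)) (n : ℕ) :
    Measurable (fun w : Fin (n + 1) → S => auxD q w) := by
  unfold auxD
  refine Finset.measurable_prod _ fun k _ => ?_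
  have h2 : Measurable (fun w : Fin (n + 1) → S => (w k.succ, w k.castSucc)) :=
    (measurable_pi_apply k.succ).prodMk (measurable_pi_apply k.castSucc)
  exact hq.comp h2

theorem aux_measurable_cons (z : S) (n : ℕ) :
    Measurable (fun w : Fin n → S => (Fin.cons z w : Fin (n + 1) → S)) := by
  refine measurable_pi_lambda _ fun k => ?_
  refine Fin.cases ?_ (fun k => ?_) k
  · simp
  · simpa using measurable_pi_apply k

theorem aux_measurable_snoc (n : ℕ) :
    Measurable (fun p : (Fin n → S) × S => (Fin.snoc p.1 p.2 : Fin (n + 1) → S)) := by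
  refine measurable_pi_lambda _ fun k => ?_
  refine Fin.lastCases ?_ (fun k => ?_) k
  · simpa using measurable_snd
  · simp only [Fin.snoc_castSucc]
    exact (measurable_pi_apply k).comp measurable_fst

theorem aux_law [MeasurableSingletonClass S] (κ : Kernel S S) (Pz : S → Measure (ℕ → S))
    (h : IsMarkovFamily κ Pz) (ν : Measure S) [SigmaFinite ν] (q : S → S → ℝ≥0∞)
    (hq : Measurable (Function.uncurry q))
    (hκ : ∀ z, κ z = ν.withDensity (fun z' => q z' z)) (z : S) (n : ℕ) :
    ∀ g : (Fin (n + 1) → S) → ℝ≥0∞, Measurable g →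
    ∫⁻ ω, g (fun k : Fin (n + 1) => ω k) ∂(Pz z) =
      ∫⁻ w : Fin n → S, auxD q (Fin.cons z w : Fin (n + 1) → S) *
        g (Fin.cons z w) ∂(Measure.pi fun _ => ν) := by
  induction n with
  | zero =>
    intro g hg
    have := h.1 z
    have h0 : ∀ᵐ ω ∂(Pz z), ω 0 = z := by
      have hm : MeasurableSet {ω : ℕ → S | ω 0 = z} :=
        (measurable_pi_apply (X := fun _ : ℕ => S) 0) (measurableSet_singleton z)
      exact (prob_compl_eq_zero_iff hm).2 (h.2.1 z)
    rw [lintegral_congr_ae (g := fun _ => g (fun _ => z))]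
    · rw [lintegral_const, measure_univ, mul_one, lintegral_unique]
      have : (Fin.cons z default : Fin 1 → S) = fun _ => z := by
        ext k; fin_cases k; rfl
      simp [auxD, this]
    · filter_upwards [h0] with ω hω
      congr 1
      ext k; fin_cases k; exact hω
  | succ n ih =>
    intro g hg
    have hqs : ∀ a : S, Measurable (fun s => q s a) := fun a =>
      hq.comp (measurable_id.prodMk measurable_const)
    have hgs : Measurable (fun p : (Fin (n + 1) → S) × S => g (Fin.snoc p.1 p.2)) :=
      hg.comp (aux_measurable_snoc _)
    have e1 : ∀ ω : ℕ → S, (fun k : Fin (n + 2) => ω k) =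
        Fin.snoc (fun k : Fin (n + 1) => ω k) (ω (n + 1)) := by
      intro ω
      ext k
      refine Fin.lastCases ?_ (fun k => ?_) k <;> simp
    simp_rw [e1]
    rw [aux_step κ Pz h z n (fun p => g (Fin.snoc p.1 p.2)) hgs]
    let G : (Fin (n + 1) → S) → ℝ≥0∞ := fun v =>
      ∫⁻ s, q s (v (Fin.last n)) * g (Fin.snoc v s) ∂ν
    have hGi : Measurable (fun p : (Fin (n + 1) → S) × S =>
        q p.2 (p.1 (Fin.last n)) * g (Fin.snoc p.1 p.2)) := by
      refine Measurable.mul ?_ hgs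
      exact hq.comp (measurable_snd.prodMk ((measurable_pi_apply _).comp measurable_fst))
    have hG : Measurable G := hGi.lintegral_prod_right'
    have e2 : ∀ ω : ℕ → S, ∫⁻ z', g (Fin.snoc (fun k : Fin (n + 1) => ω k) z') ∂(κ (ω n)) =
        G (fun k : Fin (n + 1) => ω k) := by
      intro ω
      have hm : Measurable (fun z' => g (Fin.snoc (fun k : Fin (n + 1) => ω k) z')) :=
        hgs.comp (measurable_const.prodMk measurable_id)
      rw [hκ, lintegral_withDensity_eq_lintegral_mul _ (hqs _) hm]
      simp [G]
    simp only [e2]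
    rw [ih G hG]
    have mp := (measurePreserving_piFinSuccAbove (fun _ : Fin (n + 1) => ν) (Fin.last n)).symm
    rw [← mp.lintegral_comp_emb (MeasurableEquiv.measurableEmbedding _)]
    have e3 : ∀ p : S × (Fin n → S),
        (MeasurableEquiv.piFinSuccAbove (fun _ : Fin (n + 1) => S) (Fin.last n)).symm p =
        (Fin.snoc p.2 p.1 : Fin (n + 1) → S) := by
      intro p
      simp [MeasurableEquiv.piFinSuccAbove]
      rfl
    have e4 : ∀ p : S × (Fin n → S),
        auxD q (Fin.cons z (Fin.snoc p.2 p.1 : Fin (n + 1) → S) : Fin (n + 2) → S) *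
          g (Fin.cons z (Fin.snoc p.2 p.1 : Fin (n + 1) → S)) =
        auxD q (Fin.cons z p.2 : Fin (n + 1) → S) *
          (q p.1 ((Fin.cons z p.2 : Fin (n + 1) → S) (Fin.last n)) *
            g (Fin.snoc (Fin.cons z p.2 : Fin (n + 1) → S) p.1)) := by
      intro p
      have : (Fin.cons z (Fin.snoc p.2 p.1 : Fin (n + 1) → S) : Fin (n + 2) → S) =
          Fin.snoc (Fin.cons z p.2 : Fin (n + 1) → S) p.1 :=
        Fin.cons_snoc_eq_snoc_cons z p.2 p.1
      rw [this, ← mul_assoc]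
      congr 1
      unfold auxD
      rw [Fin.prod_univ_castSucc]
      simp only [Fin.snoc_castSucc, Fin.succ_last, Fin.snoc_last, Fin.succ_castSucc]
    simp_rw [e3, e4]
    have hc : Measurable (fun p : S × (Fin n → S) => (Fin.cons z p.2 : Fin (n + 1) → S)) :=
      (aux_measurable_cons z n).comp measurable_snd
    rw [lintegral_prod_symm]
    · refine lintegral_congr fun w => ?_
      simp only [G]
      rw [lintegral_const_mul]
      have hw : Measurable (fun s : S => ((Fin.cons z w : Fin (n + 1) → S), s)) :=
        measurable_const.prodMk measurable_id
      exact hGi.comp hw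
    · refine Measurable.aemeasurable ?_
      exact ((aux_measurable_D q hq n).comp hc).mul (hGi.comp (hc.prodMk measurable_fst))

end Aux

/-- Under **A1**, **A2** and the bounds `1/n₀ ≤ p_{ij} ≤ n₀` on `E × Y⁺`,
for every `z = (x₁, i) ∈ E_(1) × Y⁺_(1)`,
`P_z(X_{1:r} ∈ E) ≥ (|Y⁺_(2)|/n₀) · μ^{r−1}(E(x₁)) > 0`. -/
theorem reaching_E_positive_probability
    [TopologicalSpace 𝓧] [PolishSpace 𝓧] [BorelSpace 𝓧]
    (κ : Kernel (𝓧 × 𝓨) (𝓧 × 𝓨)) (μ : Measure 𝓧)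
    (q : 𝓧 × 𝓨 → 𝓧 × 𝓨 → ℝ≥0∞)
    (Pz : 𝓧 × 𝓨 → Measure (ℕ → 𝓧 × 𝓨)) (ψ : Measure (𝓧 × 𝓨))
    {R : ℕ} (E : Set (Fin (R + 1) → 𝓧)) (Yp : Set (𝓨 × 𝓨))
    (hμ : SigmaFinite μ) (hq : Measurable (Function.uncurry q))
    (hκ : ∀ z : 𝓧 × 𝓨, (κ z : Measure (𝓧 × 𝓨)) =
      (μ.prod Measure.count).withDensity (fun z' => q z' z))
    (hFam : IsMarkovFamily κ Pz)
    (hA1 : Assumption1 q E Yp) (hA2 : Assumption2 κ ψ μ E Yp)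
    (n₀ : ℕ) (hn₀ : 1 ≤ n₀)
    (hbound : ∀ x ∈ E, ∀ p ∈ Yp,
      ((n₀ : ℝ≥0∞))⁻¹ ≤ pijD q x p.1 p.2 ∧ pijD q x p.1 p.2 ≤ (n₀ : ℝ≥0∞))
    (x₁ : 𝓧) (i : 𝓨) (hx : x₁ ∈ proj1 E) (hi : i ∈ Prod.fst '' Yp) :
    ((Prod.snd '' Yp).ncard : ℝ≥0∞) / (n₀ : ℝ≥0∞) *
        (Measure.pi fun _ : Fin R => μ) (secSet E x₁)
      ≤ Pz (x₁, i) {ω | (fun k : Fin (R + 1) => (ω (k : ℕ)).1) ∈ E} ∧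
    0 < Pz (x₁, i) {ω | (fun k : Fin (R + 1) => (ω (k : ℕ)).1) ∈ E} := by
  haveI := hμ
  haveI := hFam.1 (x₁, i)
  have hcount : SigmaFinite (Measure.count : Measure 𝓨) := inferInstance
  let f : (ℕ → 𝓧 × 𝓨) → (Fin (R + 1) → 𝓧) := fun ω k => (ω (k : ℕ)).1
  have hf : Measurable f :=
    measurable_pi_lambda _ fun k => measurable_fst.comp (measurable_pi_apply _)
  set c : ℝ≥0∞ := ((Prod.snd '' Yp).ncard : ℝ≥0∞) / (n₀ : ℝ≥0∞) with hc
  have hA : (Pz (x₁, i)).map f E ≤ Pz (x₁, i) (f ⁻¹' E) := aux_map_le _ f hf E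
  -- the pairing of strings
  let pr : (Fin R → 𝓧) → (Fin R → 𝓨) → (Fin (R + 1) → 𝓧 × 𝓨) := fun x y =>
    Fin.cons (x₁, i) (fun k => (x k, y k))
  have hpr : ∀ x y k, pr x y k =
      ((Fin.cons x₁ x : Fin (R + 1) → 𝓧) k, (Fin.cons i y : Fin (R + 1) → 𝓨) k) := by
    intro x y k
    refine Fin.cases ?_ (fun k => ?_) k <;> simp [pr]
  let Q : (Fin R → 𝓧) → ℝ≥0∞ := fun x => ∑ y : Fin R → 𝓨, auxD q (pr x y)
  have hprm : ∀ y, Measurable (fun x => pr x y) := by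
    intro y
    refine (aux_measurable_cons (x₁, i) R).comp ?_
    exact measurable_pi_lambda _ fun k => (measurable_pi_apply k).prodMk measurable_const
  have hQ : Measurable Q :=
    Finset.measurable_sum _ fun y _ => (aux_measurable_D q hq R).comp (hprm y)
  -- lower bound of the density
  have hQc : ∀ x ∈ secSet E x₁, c ≤ Q x := by
    intro x hxE
    have hxE : (Fin.cons x₁ x : Fin (R + 1) → 𝓧) ∈ E := hxE
    have h1 : ∑ j : 𝓨, pijD q (Fin.cons x₁ x : Fin (R + 1) → 𝓧) i j = Q x := by
      unfold pijD
      rw [Finset.sum_comm]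
      rw [← (Fin.consEquiv (fun _ : Fin (R + 1) => 𝓨)).sum_comp, Fintype.sum_prod_type]
      rw [Finset.sum_eq_single i]
      · refine Finset.sum_congr rfl fun y _ => ?_
        simp only [Fin.consEquiv_apply, Fin.cons_zero, true_and]
        rw [Finset.sum_ite_eq]
        simp only [Finset.mem_univ, if_true, auxD, hpr]
      · intro b _ hb
        simp [Fin.consEquiv_apply, hb]
      · simp
    rw [← h1]
    classical
    have hfin : (Prod.snd '' Yp).Finite := Set.toFinite _
    calc c = ∑ j ∈ hfin.toFinset, ((n₀ : ℝ≥0∞))⁻¹ := by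
          rw [Finset.sum_const, nsmul_eq_mul, hc, Set.ncard_eq_toFinset_card _ hfin,
            div_eq_mul_inv]
      _ ≤ ∑ j ∈ hfin.toFinset, pijD q (Fin.cons x₁ x : Fin (R + 1) → 𝓧) i j := by
          refine Finset.sum_le_sum fun j hj => ?_
          have hj : j ∈ Prod.snd '' Yp := by simpa using hj
          have hij : (i, j) ∈ Yp := by
            rw [hA1.2.2.2]
            exact ⟨hi, hj⟩
          exact (hbound _ hxE (i, j) hij).1
      _ ≤ _ := Finset.sum_le_sum_of_subset (Finset.subset_univ _)
  have hB : c * (Measure.pi fun _ : Fin R => μ) (secSet E x₁) ≤ (Pz (x₁, i)).map f E := by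
    set C := toMeasurable ((Pz (x₁, i)).map f) E with hC
    have hCm : MeasurableSet C := measurableSet_toMeasurable _ _
    rw [← measure_toMeasurable E, Measure.map_apply hf hCm]
    let fX : (Fin (R + 1) → 𝓧 × 𝓨) → (Fin (R + 1) → 𝓧) := fun w k => (w k).1
    have hfX : Measurable fX :=
      measurable_pi_lambda _ fun k => measurable_fst.comp (measurable_pi_apply _)
    let g : (Fin (R + 1) → 𝓧 × 𝓨) → ℝ≥0∞ := fun w => C.indicator 1 (fX w)
    have hg : Measurable g := (measurable_one.indicator hCm).comp hfX
    have hlaw := aux_law κ Pz hFam (μ.prod Measure.count) q hq hκ (x₁, i) R g hg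
    have hL : ∫⁻ ω, g (fun k : Fin (R + 1) => ω k) ∂(Pz (x₁, i)) = Pz (x₁, i) (f ⁻¹' C) := by
      rw [← lintegral_indicator_one (hf hCm)]
      rfl
    have mp := (measurePreserving_arrowProdEquivProdArrow 𝓧 𝓨 (Fin R) (fun _ => μ)
      (fun _ => (Measure.count : Measure 𝓨))).symm
    rw [← mp.lintegral_comp_emb (MeasurableEquiv.measurableEmbedding _)] at hlaw
    have hcm := aux_measurable_cons ((x₁, i) : 𝓧 × 𝓨) R
    have hint : Measurable (fun w : Fin R → 𝓧 × 𝓨 =>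
        auxD q (Fin.cons (x₁, i) w : Fin (R + 1) → 𝓧 × 𝓨) * g (Fin.cons (x₁, i) w)) :=
      ((aux_measurable_D q hq R).comp hcm).mul (hg.comp hcm)
    have hint2 := hint.comp (MeasurableEquiv.arrowProdEquivProdArrow 𝓧 𝓨 (Fin R)).symm.measurable
    simp only [Function.comp_def] at hint2
    rw [lintegral_prod _ hint2.aemeasurable] at hlaw
    have hinner : ∀ x : Fin R → 𝓧, (∫⁻ y : Fin R → 𝓨,
        auxD q (Fin.cons (x₁, i) ((MeasurableEquiv.arrowProdEquivProdArrow 𝓧 𝓨 (Fin R)).symm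
          (x, y)) : Fin (R + 1) → 𝓧 × 𝓨) *
        g (Fin.cons (x₁, i) ((MeasurableEquiv.arrowProdEquivProdArrow 𝓧 𝓨 (Fin R)).symm (x, y)))
          ∂(Measure.pi fun _ => Measure.count)) =
        Q x * C.indicator 1 (Fin.cons x₁ x : Fin (R + 1) → 𝓧) := by
      intro x
      rw [lintegral_fintype, Finset.sum_mul]
      refine Finset.sum_congr rfl fun y _ => ?_
      have h1 : (Fin.cons (x₁, i) ((MeasurableEquiv.arrowProdEquivProdArrow 𝓧 𝓨 (Fin R)).symm
          (x, y)) : Fin (R + 1) → 𝓧 × 𝓨) = pr x y := rfl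
      have h2 : fX (pr x y) = (Fin.cons x₁ x : Fin (R + 1) → 𝓧) := by
        ext k
        simp [fX, hpr]
      rw [h1, Measure.pi_singleton]
      simp [g, h2]
    simp only [hinner] at hlaw
    rw [← hL, hlaw]
    have hsub : secSet E x₁ ⊆
        {x | c ≤ Q x * C.indicator 1 (Fin.cons x₁ x : Fin (R + 1) → 𝓧)} := by
      intro x hxE
      have hxC : (Fin.cons x₁ x : Fin (R + 1) → 𝓧) ∈ C := subset_toMeasurable _ _ hxE
      simpa [hxC] using hQc x hxE
    refine (mul_le_mul_right (measure_mono hsub) c).trans ?_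
    exact mul_meas_ge_le_lintegral
      (hQ.mul ((measurable_one.indicator hCm).comp (aux_measurable_cons x₁ R))) c
  have hfinal := hB.trans hA
  refine ⟨hfinal, lt_of_lt_of_le ?_ hfinal⟩
  refine ENNReal.mul_pos ?_ (hA2.2.2 x₁ hx).ne'
  refine (ENNReal.div_pos ?_ (ENNReal.natCast_ne_top n₀)).ne'
  have : (Prod.snd '' Yp).Nonempty := hA1.2.1.image _
  have := (Set.ncard_pos (Set.toFinite _)).2 this
  exact_mod_cast this.ne'

end PMMPaper
end
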